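/- For every positive integer k and every real δ > 0 there exists q₀ such that for every prime q ≥ q₀ and every red–blue colouring of ℤ/qℤ with at least δ·q blue elements and at least two red elements, there exist x, d ∈ ℤ/qℤ with d ≠ 0 such that x and x + d are red and x + 2d, x + 3d, …, x + (k+1)d are all blue. -/

import Mathlib

namespace DHJ
open Finset
open scoped BigOperators

noncomputable def ex {X : Type} [Finite X] (h : X → ℝ) : ℝ :=
  letI := Fintype.ofFinite X
  (∑ x, h x) / (Nat.card X : ℝ)

theorem ex_eq {X : Type} [Fintype X] (h : X → ℝ) : ex h = (∑ x, h x) / (Nat.card X : ℝ) := by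
  unfold ex
  congr!

section
variable {X Y : Type} [Finite X] [Finite Y]

theorem card_pos' (X : Type) [Finite X] [Nonempty X] : (0:ℝ) < Nat.card X := by
  exact_mod_cast Nat.card_pos

theorem ex_const [Nonempty X] (c : ℝ) : ex (fun _ : X => c) = c := by
  let _ := Fintype.ofFinite X
  rw [ex_eq]
  have := card_pos' X
  simp only [sum_const, card_univ, nsmul_eq_mul, ← Nat.card_eq_fintype_card]
  field_simp

theorem ex_add (f g : X → ℝ) : ex (fun x => f x + g x) = ex f + ex g := by
  let _ := Fintype.ofFinite X
  simp only [ex_eq, sum_add_distrib, add_div]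

theorem ex_sub (f g : X → ℝ) : ex (fun x => f x - g x) = ex f - ex g := by
  let _ := Fintype.ofFinite X
  simp only [ex_eq, sum_sub_distrib, sub_div]

theorem ex_mul (c : ℝ) (f : X → ℝ) : ex (fun x => c * f x) = c * ex f := by
  let _ := Fintype.ofFinite X
  simp only [ex_eq, ← mul_sum, mul_div_assoc]

theorem ex_sum {F : Type} (s : Finset F) (f : F → X → ℝ) :
    ex (fun x => ∑ i ∈ s, f i x) = ∑ i ∈ s, ex (f i) := by
  let _ := Fintype.ofFinite X
  simp only [ex_eq, ← sum_div]
  rw [sum_comm]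

theorem ex_mono {f g : X → ℝ} (h : ∀ x, f x ≤ g x) : ex f ≤ ex g := by
  let _ := Fintype.ofFinite X
  simp only [ex_eq]
  have : ∑ x, f x ≤ ∑ x, g x := sum_le_sum (fun x _ => h x)
  gcongr

theorem ex_nonneg {f : X → ℝ} (h : ∀ x, 0 ≤ f x) : 0 ≤ ex f := by
  let _ := Fintype.ofFinite X
  simp only [ex_eq]
  have : 0 ≤ ∑ x, f x := sum_nonneg (fun x _ => h x)
  positivity

theorem ex_le [Nonempty X] {f : X → ℝ} {c : ℝ} (h : ∀ x, f x ≤ c) : ex f ≤ c := by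
  have := ex_mono h
  rwa [ex_const] at this

theorem le_ex [Nonempty X] {f : X → ℝ} {c : ℝ} (h : ∀ x, c ≤ f x) : c ≤ ex f := by
  have := ex_mono h
  rwa [ex_const] at this

theorem ex_pos_nonempty {f : X → ℝ} (h : 0 < ex f) : Nonempty X := by
  by_contra hX
  have : IsEmpty X := not_nonempty_iff.mp hX
  let _ := Fintype.ofFinite X
  rw [ex_eq] at h
  simp at h

theorem exists_ge [Nonempty X] {f : X → ℝ} {c : ℝ} (h : c ≤ ex f) : ∃ x, c ≤ f x := by
  by_contra hc
  push Not at hc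
  let _ := Fintype.ofFinite X
  rw [ex_eq, le_div_iff₀ (card_pos' X)] at h
  have : ∑ x, f x < ∑ x : X, c := sum_lt_sum_of_nonempty univ_nonempty (fun x _ => hc x)
  simp only [sum_const, card_univ, nsmul_eq_mul, ← Nat.card_eq_fintype_card] at this
  linarith

theorem ex_equiv (e : X ≃ Y) (f : Y → ℝ) : ex (fun x => f (e x)) = ex f := by
  let _ := Fintype.ofFinite X
  let _ := Fintype.ofFinite Y
  rw [ex_eq, ex_eq, Nat.card_congr e, Equiv.sum_comp e f]

theorem ex_prod (f : X × Y → ℝ) : ex f = ex (fun x => ex (fun y => f (x, y))) := by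
  let _ := Fintype.ofFinite X
  let _ := Fintype.ofFinite Y
  simp only [ex_eq]
  rw [Fintype.sum_prod_type, ← sum_div, Nat.card_prod, Nat.cast_mul, div_div, mul_comm]

theorem ex_comm (f : X → Y → ℝ) : ex (fun x => ex (fun y => f x y)) = ex (fun y => ex (fun x => f x y)) := by
  let _ := Fintype.ofFinite X
  let _ := Fintype.ofFinite Y
  simp only [ex_eq]
  rw [← sum_div, ← sum_div, sum_comm, div_div, div_div, mul_comm]

theorem ex_single {f : X → ℝ} (h : ∀ x, 0 ≤ f x) (x : X) : f x / Nat.card X ≤ ex f := by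
  let _ := Fintype.ofFinite X
  rw [ex_eq]
  have : f x ≤ ∑ x, f x := single_le_sum (fun x _ => h x) (mem_univ x)
  gcongr

theorem ex_exists_gt (F : X → ℝ) {ε : ℝ} (hε : 0 < ε) (x0 : X) (h0 : F x0 < ex F - ε) :
    ∃ x, ex F + ε / Nat.card X ≤ F x := by
  by_contra hc
  push Not at hc
  have : Nonempty X := ⟨x0⟩
  have hn := card_pos' X
  set n : ℝ := (Nat.card X : ℝ)
  have h1 : ∀ x, 0 ≤ ex F + ε / n - F x := fun x => by linarith [hc x]
  have h2 := ex_single h1 x0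
  rw [ex_sub, ex_const] at h2
  have h3 : ε / n + ε < ex F + ε / n - F x0 := by linarith
  have h4 : (ε/n + ε) / n < ε / n := by
    have : (ε/n + ε) / n < (ex F + ε / n - F x0)/n := by gcongr
    change _ ≤ _ at h2
    linarith
  have h5 : (ε/n+ε)/n = ε/n + ε/n/n := by ring
  have : 0 < ε/n/n := by positivity
  linarith

end

open Classical in
noncomputable def ind (P : Prop) : ℝ := if P then 1 else 0

theorem ind_true {P : Prop} (h : P) : ind P = 1 := by simp [ind, h]
theorem ind_false {P : Prop} (h : ¬ P) : ind P = 0 := by simp [ind, h]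
theorem ind_nonneg (P : Prop) : 0 ≤ ind P := by unfold ind; split_ifs <;> norm_num
theorem ind_le_one (P : Prop) : ind P ≤ 1 := by unfold ind; split_ifs <;> norm_num
theorem ind_and (P Q : Prop) : ind (P ∧ Q) = ind P * ind Q := by
  by_cases hP : P <;> by_cases hQ : Q <;> simp [ind, hP, hQ]
theorem ind_not (P : Prop) : ind (¬ P) = 1 - ind P := by
  by_cases hP : P <;> simp [ind, hP]
theorem ind_mono {P Q : Prop} (h : P → Q) : ind P ≤ ind Q := by
  by_cases hP : P
  · rw [ind_true hP, ind_true (h hP)]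
  · rw [ind_false hP]; exact ind_nonneg _
theorem ind_congr {P Q : Prop} (h : P ↔ Q) : ind P = ind Q := by rw [propext h]

theorem exists_of_ex_ind_pos {X : Type} [Finite X] {P : X → Prop} (h : 0 < ex (fun x => ind (P x))) :
    ∃ x, P x := by
  have := ex_pos_nonempty h
  by_contra hc
  push Not at hc
  have : ex (fun x => ind (P x)) ≤ 0 := ex_le (fun x => (ind_false (hc x)).le)
  linarith

theorem fiber {X : Type} [Finite X] {g : X → ℝ} (h1 : ∀ x, g x ≤ 1) {e : ℝ} (he : 0 < e)
    (h : e ≤ ex g) : e / 2 ≤ ex (fun x => ind (e / 2 ≤ g x)) := by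
  have := ex_pos_nonempty (lt_of_lt_of_le he h)
  have h2 : ∀ x, g x ≤ e / 2 + ind (e / 2 ≤ g x) := by
    intro x
    by_cases hx : e / 2 ≤ g x
    · rw [ind_true hx]; linarith [h1 x]
    · rw [ind_false hx]; linarith
  have := ex_mono h2
  rw [ex_add, ex_const] at this
  linarith

theorem pigeon {X F : Type} [Finite X] [Finite F] (P : X → Prop) (Q : F → X → Prop)
    (hPQ : ∀ x, P x → ∃ V, Q V x) {c : ℝ} (hc : 0 < c) (h : c ≤ ex (fun x => ind (P x))) :
    ∃ V, c / Nat.card F ≤ ex (fun x => ind (Q V x)) := by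
  let _ := Fintype.ofFinite F
  have h2 : ∀ x, ind (P x) ≤ ∑ V, ind (Q V x) := by
    intro x
    by_cases hx : P x
    · obtain ⟨V, hV⟩ := hPQ x hx
      rw [ind_true hx, ← ind_true hV]
      exact single_le_sum (f := fun V => ind (Q V x)) (fun _ _ => ind_nonneg _) (mem_univ V)
    · rw [ind_false hx]; exact sum_nonneg (fun _ _ => ind_nonneg _)
  have h3 := ex_mono h2
  rw [ex_sum] at h3
  have : Nonempty F := by
    obtain ⟨x, hx⟩ := exists_of_ex_ind_pos (lt_of_lt_of_le hc h)
    exact ⟨(hPQ x hx).choose⟩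
  apply exists_ge
  rw [ex_eq]
  have := card_pos' F
  gcongr
  linarith

/-! ### words -/

def sub {ι β η : Type} (f : ι → β ⊕ η) (x : η → β) : ι → β := fun i => (f i).elim id x
def Proper {ι β η : Type} (f : ι → β ⊕ η) : Prop := ∀ e, ∃ i, f i = Sum.inr e
def comp {ι β η ζ : Type} (f : ι → β ⊕ η) (g : η → β ⊕ ζ) : ι → β ⊕ ζ :=
  fun i => (f i).elim Sum.inl g
def lift {ι α η : Type} (f : ι → α ⊕ η) : ι → Option α ⊕ η := fun i => (f i).map some id
def mk {J I J' β : Type} (e : J ≃ I ⊕ J') (x : I → β) (y : J' → β) : J → β :=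
  fun j => Sum.elim x y (e j)

theorem sub_comp {ι β η ζ : Type} (f : ι → β ⊕ η) (g : η → β ⊕ ζ) (x : ζ → β) :
    sub (comp f g) x = sub f (sub g x) := by
  funext i
  unfold sub comp
  cases h : f i <;> simp [h]

theorem Proper.comp {ι β η ζ : Type} {f : ι → β ⊕ η} {g : η → β ⊕ ζ} (hf : Proper f)
    (hg : Proper g) : Proper (DHJ.comp f g) := by
  intro e
  obtain ⟨j, hj⟩ := hg e
  obtain ⟨i, hi⟩ := hf j
  exact ⟨i, by simp [DHJ.comp, hi, hj]⟩

theorem sub_inl {ι β η : Type} (y : ι → β) (x : η → β) : sub (fun i => Sum.inl (y i)) x = y := rfl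
theorem sub_inr {η β : Type} (x : η → β) : sub (fun i => Sum.inr i) x = x := rfl

theorem sub_mk {J I J' β η : Type} (e : J ≃ I ⊕ J') (V : I → β ⊕ η) (W : J' → β ⊕ η) (v : η → β) :
    sub (mk e V W) v = mk e (sub V v) (sub W v) := by
  funext j
  unfold sub mk
  cases e j <;> rfl

theorem Proper.mkl {J I J' β η : Type} (e : J ≃ I ⊕ J') {V : I → β ⊕ η} (W : J' → β ⊕ η)
    (hV : Proper V) : Proper (mk e V W) := by
  intro a
  obtain ⟨i, hi⟩ := hV a
  exact ⟨e.symm (Sum.inl i), by simp [mk, hi]⟩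

theorem Proper.mkr {J I J' β η : Type} (e : J ≃ I ⊕ J') (V : I → β ⊕ η) {W : J' → β ⊕ η}
    (hW : Proper W) : Proper (mk e V W) := by
  intro a
  obtain ⟨i, hi⟩ := hW a
  exact ⟨e.symm (Sum.inr i), by simp [mk, hi]⟩

theorem Proper.lift {ι α η : Type} {f : ι → α ⊕ η} (hf : Proper f) : Proper (DHJ.lift f) := by
  intro e
  obtain ⟨i, hi⟩ := hf e
  exact ⟨i, by simp [DHJ.lift, hi]⟩

theorem lift_comp {ι α η ζ : Type} (f : ι → α ⊕ η) (g : η → α ⊕ ζ) :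
    lift (comp f g) = comp (lift f) (lift g) := by
  funext i
  unfold lift comp
  cases h : f i <;> simp [h]

theorem sub_injective {ι β η : Type} {f : ι → β ⊕ η} (hf : Proper f) :
    Function.Injective (sub f) := by
  intro x y h
  funext e
  obtain ⟨i, hi⟩ := hf e
  have := congrFun h i
  simpa [sub, hi] using this

theorem split {J : Type} [Finite J] {I : Type} [Finite I] (h : Nat.card I ≤ Nat.card J) :
    ∃ (J' : Type) (_ : Finite J') (_ : J ≃ I ⊕ J'), Nat.card J = Nat.card I + Nat.card J' := by
  refine ⟨Fin (Nat.card J - Nat.card I), inferInstance, ?_, ?_⟩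
  · apply Classical.choice
    refine ⟨(Finite.equivFin J).trans ((finCongr ?_).trans (Finite.equivFin _).symm)⟩
    rw [Nat.card_sum, Nat.card_fin]; omega
  · rw [Nat.card_fin]; omega

def mkEquiv {J I J' : Type} (β : Type) (e : J ≃ I ⊕ J') : (I → β) × (J' → β) ≃ (J → β) where
  toFun p := mk e p.1 p.2
  invFun z := (fun i => z (e.symm (Sum.inl i)), fun i => z (e.symm (Sum.inr i)))
  left_inv p := by
    ext i <;> simp [mk]
  right_inv z := by
    funext j
    simp only [mk]
    cases h : e j with
    | inl i => simp [h]; simp [← h]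
    | inr i => simp [h]; simp [← h]

theorem ex_mk {J I J' β : Type} [Finite J] [Finite I] [Finite J'] [Finite β] (e : J ≃ I ⊕ J')
    (h : (J → β) → ℝ) : ex h = ex (fun x : I → β => ex (fun y : J' → β => h (mk e x y))) := by
  rw [← ex_equiv (mkEquiv β e), ex_prod]
  rfl

theorem ex_mk' {J I J' β : Type} [Finite J] [Finite I] [Finite J'] [Finite β] (e : J ≃ I ⊕ J')
    (h : (J → β) → ℝ) : ex h = ex (fun y : J' → β => ex (fun x : I → β => h (mk e x y))) := by
  rw [ex_mk e, ex_comm]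

/-- Lemma A -/
theorem lemmaA_aux {β I : Type} [Finite β] [Nonempty β] [Finite I] {ε : ℝ} (hε : 0 < ε) (t : ℕ) :
    ∀ (J : Type) [Finite J], t * Nat.card I ≤ Nat.card J → ∀ h : (J → β) → ℝ, (∀ x, h x ≤ 1) →
      1 - t * (ε / Nat.card (I → β)) < ex h →
      ∃ (Y : Type) (_ : Finite Y) (_ : Nonempty Y) (g : Y → J → β ⊕ I), (∀ y, Proper (g y)) ∧
        ∀ x, ex h - ε ≤ ex (fun y => h (sub (g y) x)) := by
  induction t with
  | zero =>
    intro J _ _ h h1 h2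
    have := ex_le h1
    simp at h2
    linarith
  | succ t ih =>
    intro J _ hJ h h1 h2
    obtain ⟨J', _, e, hc⟩ := split (J := J) (I := I) (by nlinarith)
    by_cases hall : ∀ x : I → β, ex h - ε ≤ ex (fun y : J' → β => h (mk e x y))
    · refine ⟨J' → β, inferInstance, inferInstance,
        fun y => mk e (fun i => Sum.inr i) (fun j => Sum.inl (y j)), ?_, ?_⟩
      · intro y
        apply Proper.mkl
        exact fun i => ⟨i, rfl⟩
      · intro x
        simp only [sub_mk]
        exact hall x
    · push Not at hall
      obtain ⟨x0, hx0⟩ := hall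
      rw [ex_mk e h] at hx0
      obtain ⟨x, hx⟩ := ex_exists_gt (fun x : I → β => ex (fun y : J' → β => h (mk e x y))) hε x0 hx0
      rw [← ex_mk e h] at hx
      have hpos : 0 < ε / Nat.card (I → β) := div_pos hε (card_pos' _)
      obtain ⟨Y, hY, hY', g, hg, hgx⟩ := ih J' (by rw [hc] at hJ; linarith) (fun y => h (mk e x y))
        (fun _ => h1 _) (by push_cast at h2; linarith)
      refine ⟨Y, hY, hY', fun y => mk e (fun i => Sum.inl (x i)) (g y), ?_, ?_⟩
      · intro y
        exact Proper.mkr _ _ (hg y)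
      · intro z
        have := hgx z
        simp only [sub_mk]
        change _ ≤ ex (fun y => h (mk e x (sub (g y) z)))
        linarith

theorem lemmaA (β I : Type) [Finite β] [Nonempty β] [Finite I] {ε : ℝ} (hε : 0 < ε) :
    ∃ N : ℕ, ∀ (J : Type) [Finite J], N ≤ Nat.card J → ∀ h : (J → β) → ℝ, (∀ x, h x ≤ 1) →
      (∀ x, 0 ≤ h x) →
      ∃ (Y : Type) (_ : Finite Y) (_ : Nonempty Y) (g : Y → J → β ⊕ I), (∀ y, Proper (g y)) ∧
        ∀ x, ex h - ε ≤ ex (fun y => h (sub (g y) x)) := by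
  have hpos : 0 < ε / Nat.card (I → β) := div_pos hε (card_pos' _)
  obtain ⟨t, ht⟩ := exists_nat_gt (1 / (ε / Nat.card (I → β)))
  refine ⟨t * Nat.card I, fun J _ hJ h h1 h0 => lemmaA_aux hε t J hJ h h1 ?_⟩
  have := ex_nonneg h0
  rw [div_lt_iff₀ hpos] at ht
  linarith

/-! ### DHJ -/

def HasLine {J α : Type} (A : (J → α) → Prop) : Prop :=
  ∃ l : J → Option α, (∃ i, l i = none) ∧ ∀ r, A (fun i => (l i).getD r)

def D (α : Type) [Finite α] (δ : ℝ) : Prop :=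
  ∃ N : ℕ, ∀ (J : Type) [Finite J], N ≤ Nat.card J → ∀ A : (J → α) → Prop,
    δ ≤ ex (fun x => ind (A x)) → HasLine A

theorem HasLine.pull {J I β : Type} {A : (J → β) → Prop} {V : J → β ⊕ I} (hV : Proper V)
    (h : HasLine (fun x => A (sub V x))) : HasLine A := by
  obtain ⟨l, ⟨i, hi⟩, hl⟩ := h
  obtain ⟨j, hj⟩ := hV i
  refine ⟨fun j => (V j).elim some l, ⟨j, by simp [hj, hi]⟩, fun r => ?_⟩
  convert hl r using 1
  funext j
  unfold sub
  cases h : V j <;> simp [h]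

theorem MD {α : Type} [Finite α] (hD : ∀ δ, 0 < δ → D α δ) (d : ℕ) :
    ∀ δ : ℝ, 0 < δ → ∃ N : ℕ, ∀ (J : Type) [Finite J], N ≤ Nat.card J → ∀ A : (J → α) → Prop,
      δ ≤ ex (fun x => ind (A x)) → ∃ f : J → α ⊕ Fin d, Proper f ∧ ∀ x, A (sub f x) := by
  induction d with
  | zero =>
    intro δ hδ
    refine ⟨0, fun J _ _ A hA => ?_⟩
    obtain ⟨x, hx⟩ := exists_of_ex_ind_pos (lt_of_lt_of_le hδ hA)
    exact ⟨fun i => Sum.inl (x i), fun e => e.elim0, fun y => hx⟩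
  | succ d ih =>
    intro δ hδ
    obtain ⟨N1, hN1⟩ := hD (δ/2) (by linarith)
    have hFpos := card_pos' (Fin N1 → Option α)
    obtain ⟨N2, hN2⟩ := ih (δ/2 / Nat.card (Fin N1 → Option α)) (by positivity)
    refine ⟨N1 + N2, fun J _ hJ A hA => ?_⟩
    obtain ⟨J', _, e, hc⟩ := split (J := J) (I := Fin N1) (by rw [Nat.card_fin]; omega)
    rw [Nat.card_fin] at hc
    rw [ex_mk' e] at hA
    have : Nonempty (J' → α) := ex_pos_nonempty (lt_of_lt_of_le hδ hA)
    have hne : Nonempty (J → α) := by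
      obtain ⟨y, hy⟩ := exists_ge hA
      have := ex_pos_nonempty (lt_of_lt_of_le hδ hy)
      exact ⟨mk e this.some y⟩
    have hne1 : Nonempty (Fin N1 → α) := ⟨fun i => hne.some (e.symm (Sum.inl i))⟩
    have h1 := fiber (fun y => ex_le (fun x => ind_le_one _)) hδ hA
    obtain ⟨l, hl⟩ := pigeon _ (fun (l : Fin N1 → Option α) (y : J' → α) =>
      (∃ i, l i = none) ∧ ∀ r, A (mk e (fun i => (l i).getD r) y))
      (fun y hy => hN1 (Fin N1) (by simp) (fun x => A (mk e x y)) hy) (by linarith) h1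
    obtain ⟨g, hg, hgx⟩ := hN2 J' (by omega) _ hl
    obtain ⟨_, hnone, _⟩ := exists_of_ex_ind_pos (lt_of_lt_of_le (by positivity) hl)
    refine ⟨mk e (fun i => (l i).elim (Sum.inr 0) Sum.inl) (fun j => (g j).map id Fin.succ), ?_, ?_⟩
    · intro a
      refine Fin.cases ?_ (fun b => ?_) a
      · obtain ⟨i, hi⟩ := hnone
        exact ⟨e.symm (Sum.inl i), by simp [mk, hi]⟩
      · obtain ⟨i, hi⟩ := hg b
        exact ⟨e.symm (Sum.inr i), by simp [mk, hi]⟩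
    · intro x
      rw [sub_mk]
      convert (hgx (fun b => x b.succ)).2 (x 0) using 2
      · funext i
        unfold sub
        cases h : l i <;> simp [h]
      · funext j
        unfold sub
        cases h : g j <;> simp [h]

end DHJ


namespace DHJ
open Finset

def Insens {α J : Type} (r : α) (E : (J → Option α) → Prop) : Prop :=
  ∀ z z' : J → Option α, (∀ i, (z i).getD r = (z' i).getD r) → (E z ↔ E z')

theorem Insens.pull {α J I : Type} {r : α} {E : (J → Option α) → Prop} (h : Insens r E)
    (V : J → Option α ⊕ I) : Insens r (fun z => E (sub V z)) := by
  intro z z' hz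
  apply h
  intro i
  unfold sub
  cases h : V i <;> simp [hz]

theorem Insens.mk {α J I J' : Type} {r : α} {E : (J → Option α) → Prop} (h : Insens r E)
    (e : J ≃ I ⊕ J') (x : I → Option α) : Insens r (fun y => E (mk e x y)) := by
  intro z z' hz
  apply h
  intro i
  unfold DHJ.mk
  cases h : e i <;> simp [hz]

theorem Insens.mk' {α J I J' : Type} {r : α} {E : (J → Option α) → Prop} (h : Insens r E)
    (e : J ≃ I ⊕ J') (y : J' → Option α) : Insens r (fun x => E (DHJ.mk e x y)) := by
  intro z z' hz
  apply h
  intro i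
  unfold DHJ.mk
  cases h : e i <;> simp [hz]

theorem Insens.not {α J : Type} {r : α} {E : (J → Option α) → Prop} (h : Insens r E) :
    Insens r (fun z => ¬ E z) := fun z z' hz => not_congr (h z z' hz)

theorem C0 {α : Type} [Finite α] (hD : ∀ δ, 0 < δ → D α δ) (r : α) (d : ℕ) {β : ℝ} (hβ : 0 < β) :
    ∃ N : ℕ, ∀ (J : Type) [Finite J], N ≤ Nat.card J → ∀ E : (J → Option α) → Prop, Insens r E →
      β ≤ ex (fun z => ind (E z)) → ∃ V : J → Option α ⊕ Fin d, Proper V ∧ ∀ v, E (sub V v) := by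
  obtain ⟨n, hn⟩ := MD hD d (β/2) (by linarith)
  obtain ⟨N, hN⟩ := lemmaA (Option α) (Fin n) (ε := β/2) (by linarith)
  refine ⟨N, fun J _ hJ E hE hd => ?_⟩
  obtain ⟨Y, _, _, g, hg, hgx⟩ := hN J hJ (fun z => ind (E z)) (fun _ => ind_le_one _)
    (fun _ => ind_nonneg _)
  have : Nonempty α := ⟨r⟩
  have h1 : β/2 ≤ ex (fun x : Fin n → α => ex (fun y => ind (E (sub (g y) (fun i => some (x i)))))) :=
    le_ex (fun x => by have := hgx (fun i => some (x i)); linarith)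
  rw [ex_comm] at h1
  obtain ⟨y, hy⟩ := exists_ge h1
  obtain ⟨f, hf, hfx⟩ := hn (Fin n) (by simp) (fun x => E (sub (g y) (fun i => some (x i)))) hy
  refine ⟨comp (g y) (lift f), (hg y).comp hf.lift, fun v => ?_⟩
  refine (hE _ _ fun i => ?_).mp (hfx (fun e => (v e).getD r))
  rw [sub_comp]
  unfold sub lift
  cases h : g y i with
  | inl a => simp
  | inr i => cases h : f i <;> simp [h]

theorem C1_aux {α : Type} [Finite α] (r : α) (d : ℕ) {β : ℝ} (hβ : 0 < β) (N : ℕ)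
    (hN : ∀ (J : Type) [Finite J], N ≤ Nat.card J → ∀ E : (J → Option α) → Prop, Insens r E →
      β / 2 ≤ ex (fun z => ind (E z)) → ∃ V : J → Option α ⊕ Fin d, Proper V ∧ ∀ v, E (sub V v))
    {c : ℝ} (hc0 : 0 < c) (hc1 : c ≤ 1)
    (hc : c = β / 2 / Nat.card (Fin N → Option α ⊕ Fin d) / Nat.card (Fin N → Option α)) (t : ℕ) :
    ∀ (J : Type) [Finite J], t * N ≤ Nat.card J → ∀ E : (J → Option α) → Prop, Insens r E →
      ∀ w : (J → Option α) → ℝ, (∀ z, w z ≤ 1) →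
      (∀ V : J → Option α ⊕ Fin d, Proper V → ex (fun v => w (sub V v)) ≤ 0) →
      ex (fun z => ind (E z) * w z) ≤ β + (1 - c) ^ t * ex (fun z => ind (E z)) := by
  have hind : ∀ (P : Prop) (x : ℝ), x ≤ 1 → ind P * x ≤ ind P := fun P x hx => by
    have := ind_nonneg P
    nlinarith
  induction t with
  | zero =>
    intro J _ _ E hE w w1 hw
    have : ex (fun z => ind (E z) * w z) ≤ ex (fun z => ind (E z)) :=
      ex_mono (fun z => hind _ _ (w1 z))
    simp
    linarith
  | succ t ih =>
    intro J _ hJ E hE w w1 hw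
    have hp : 0 ≤ (1-c)^(t+1) := by apply pow_nonneg; linarith
    have hE0 : 0 ≤ ex (fun z => ind (E z)) := ex_nonneg (fun _ => ind_nonneg _)
    have hE1 : ex (fun z => ind (E z)) ≤ 1 := ex_le (fun _ => ind_le_one _)
    by_cases hdense : ex (fun z => ind (E z)) < β
    · have : ex (fun z => ind (E z) * w z) ≤ ex (fun z => ind (E z)) :=
        ex_mono (fun z => hind _ _ (w1 z))
      nlinarith
    push Not at hdense
    obtain ⟨J', _, e, hcJ⟩ := split (J := J) (I := Fin N) (by rw [Nat.card_fin]; nlinarith)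
    rw [Nat.card_fin] at hcJ
    have hd' := hdense
    rw [ex_mk' e] at hd'
    have h1 := fiber (fun y => ex_le (fun x => ind_le_one _)) hβ hd'
    obtain ⟨V, hV⟩ := pigeon _ (fun (V : Fin N → Option α ⊕ Fin d) (y : J' → Option α) =>
      Proper V ∧ ∀ v, E (mk e (sub V v) y))
      (fun y hy => hN (Fin N) (by simp) (fun x => E (mk e x y)) (hE.mk' e y) hy) (by linarith) h1
    obtain ⟨_, hVp, _⟩ := exists_of_ex_ind_pos (lt_of_lt_of_le
      (by have := card_pos' (Fin N → Option α ⊕ Fin d)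
          rw [hc] at hc0
          positivity) hV)
    set Y : (J' → Option α) → Prop := fun y => ∀ v, E (mk e (sub V v) y) with hYdef
    have hV' : β / 2 / Nat.card (Fin N → Option α ⊕ Fin d) ≤ ex (fun y => ind (Y y)) := by
      refine hV.trans (ex_mono fun y => ind_mono fun h => h.2)
    have hYins : Insens r Y := by
      intro z z' hz
      exact forall_congr' fun v => hE.mk e (sub V v) z z' hz
    set InV : (Fin N → Option α) → Prop := fun x => ∃ v, sub V v = x
    set E' : (Fin N → Option α) → (J' → Option α) → Prop :=
      fun x y => E (mk e x y) ∧ ¬ (InV x ∧ Y y) with hE'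
    have hE'ins : ∀ x, Insens r (E' x) := fun x z z' hz =>
      and_congr (hE.mk e x z z' hz) (not_congr (and_congr Iff.rfl (hYins z z' hz)))
    have hsplit : ∀ x y, ind (E (mk e x y)) = ind (E' x y) + ind (InV x) * ind (Y y) := by
      intro x y
      by_cases h1 : InV x ∧ Y y
      · obtain ⟨⟨v, rfl⟩, hy⟩ := h1
        have h2 : InV (sub V v) := ⟨v, rfl⟩
        rw [ind_true (hy v), ind_true h2, ind_true hy, ind_false]
        · norm_num
        · exact fun h => h.2 ⟨h2, hy⟩
      · rw [← ind_and, ind_false h1, add_zero]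
        exact ind_congr ⟨fun h => ⟨h, h1⟩, fun h => h.1⟩
    have hInV : ∀ u : (Fin N → Option α) → ℝ, ex (fun v : Fin d → Option α => u (sub V v)) ≤ 0 →
        ex (fun x => ind (InV x) * u x) ≤ 0 := by
      intro u hu
      let _ := Fintype.ofFinite (Fin N → Option α)
      let _ := Fintype.ofFinite (Fin d → Option α)
      rw [ex_eq] at hu ⊢
      have h2 : ∑ v, u (sub V v) = ∑ x, ind (InV x) * u x := by
        classical
        have h3 : ∀ x, ind (InV x) * u x = if x ∈ univ.image (sub V) then u x else 0 := by
          intro x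
          by_cases hx : InV x
          · rw [ind_true hx, if_pos, one_mul]
            obtain ⟨v, hv⟩ := hx
            exact mem_image.mpr ⟨v, mem_univ _, hv⟩
          · rw [ind_false hx, if_neg, zero_mul]
            intro h
            obtain ⟨v, _, hv⟩ := mem_image.mp h
            exact hx ⟨v, hv⟩
        rw [sum_congr rfl (fun x _ => h3 x), sum_ite_mem, univ_inter,
          sum_image (fun a _ b _ h => sub_injective hVp h)]
      rw [← h2]
      have h4 := card_pos' (Fin d → Option α)
      rw [div_nonpos_iff] at hu
      apply div_nonpos_of_nonpos_of_nonneg _ (by positivity)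
      rcases hu with hu | hu
      · linarith [hu.2]
      · exact hu.1
    -- main inequality
    have hA : ex (fun z => ind (E z) * w z) =
        ex (fun x => ex (fun y => ind (E' x y) * w (mk e x y))) +
        ex (fun y => ind (Y y) * ex (fun x => ind (InV x) * w (mk e x y))) := by
      rw [ex_mk e]
      have : ∀ x y, ind (E (mk e x y)) * w (mk e x y) =
        ind (E' x y) * w (mk e x y) + ind (Y y) * (ind (InV x) * w (mk e x y)) := by
        intro x y; rw [hsplit]; ring
      simp only [this, ex_add]
      congr 1
      rw [ex_comm]
      simp only [ex_mul]
    have hB : ex (fun z => ind (E z)) = ex (fun x => ex (fun y => ind (E' x y))) +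
        ex (fun x => ind (InV x)) * ex (fun y => ind (Y y)) := by
      rw [ex_mk e]
      simp only [hsplit, ex_add, ex_mul]
      congr 1
      rw [mul_comm (ex fun x => ind (InV x)), ← ex_mul]
      simp only [mul_comm]
    have hC : ex (fun y => ind (Y y) * ex (fun x => ind (InV x) * w (mk e x y))) ≤ 0 := by
      refine ex_le fun y => mul_nonpos_of_nonneg_of_nonpos (ind_nonneg _) (hInV _ ?_)
      have := hw (mk e V (fun j => Sum.inl (y j))) (Proper.mkl _ _ hVp)
      simpa only [sub_mk, sub_inl] using this
    have hDd : ∀ x, ex (fun y => ind (E' x y) * w (mk e x y)) ≤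
        β + (1 - c)^t * ex (fun y => ind (E' x y)) := by
      intro x
      refine ih J' (by rw [hcJ] at hJ; linarith) (E' x) (hE'ins x) (fun y => w (mk e x y))
        (fun y => w1 _) ?_
      intro W hW
      have := hw (mk e (fun j => Sum.inl (x j)) W) (Proper.mkr _ _ hW)
      simpa only [sub_mk, sub_inl] using this
    have hEe := ex_mono hDd
    rw [ex_add, ex_const, ex_mul] at hEe
    have hFf : c ≤ ex (fun x => ind (InV x)) * ex (fun y => ind (Y y)) := by
      have h5 : InV (sub V fun _ => none) := ⟨_, rfl⟩
      have h6 := ex_single (fun x => ind_nonneg (InV x)) (sub V fun _ => none)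
      rw [ind_true h5] at h6
      have h7 := card_pos' (Fin N → Option α)
      have h8 : 0 < (1 / Nat.card (Fin N → Option α) : ℝ) := by positivity
      have h9 : 0 ≤ ex (fun y => ind (Y y)) := ex_nonneg (fun _ => ind_nonneg _)
      have h10 : 0 ≤ ex (fun x => ind (InV x)) := ex_nonneg (fun _ => ind_nonneg _)
      calc c = (1 / Nat.card (Fin N → Option α) : ℝ) *
            (β / 2 / Nat.card (Fin N → Option α ⊕ Fin d)) := by rw [hc]; ring
        _ ≤ _ := by gcongr
    have hGg : ex (fun x => ex (fun y => ind (E' x y))) ≤ (1 - c) * ex (fun z => ind (E z)) := by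
      nlinarith
    have hp' : 0 ≤ (1-c)^t := by apply pow_nonneg; linarith
    have := mul_le_mul_of_nonneg_left hGg hp'
    rw [pow_succ]
    linarith

theorem C1 {α : Type} [Finite α] (hD : ∀ δ, 0 < δ → D α δ) (r : α) (d : ℕ) {β : ℝ} (hβ : 0 < β) :
    ∃ M : ℕ, ∀ (J : Type) [Finite J], M ≤ Nat.card J → ∀ E : (J → Option α) → Prop, Insens r E →
      ∀ w : (J → Option α) → ℝ, (∀ z, w z ≤ 1) →
      (∀ V : J → Option α ⊕ Fin d, Proper V → ex (fun v => w (sub V v)) ≤ 0) →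
      ex (fun z => ind (E z) * w z) ≤ β := by
  wlog hβ1 : β ≤ 1 generalizing β
  · obtain ⟨M, hM⟩ := this one_pos le_rfl
    exact ⟨M, fun J _ hJ E hE w h1 h2 => (hM J hJ E hE w h1 h2).trans (by linarith)⟩
  obtain ⟨N, hN⟩ := C0 hD r d (β := β/2/2) (by linarith)
  obtain ⟨c, hc⟩ : ∃ c : ℝ, c = β/2 / 2 / Nat.card (Fin N → Option α ⊕ Fin d) / Nat.card (Fin N → Option α) := ⟨_, rfl⟩
  have h1 : (1:ℝ) ≤ Nat.card (Fin N → Option α) := by exact_mod_cast Nat.card_pos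
  have h2 : (1:ℝ) ≤ Nat.card (Fin N → Option α ⊕ Fin d) := by exact_mod_cast Nat.card_pos
  have hc0 : 0 < c := by rw [hc]; positivity
  have hc1 : c ≤ 1 / 2 := by
    rw [hc, div_div]
    apply div_le_of_le_mul₀ (by positivity) (by norm_num)
    nlinarith
  obtain ⟨t, ht⟩ := exists_pow_lt_of_lt_one (show 0 < β/2 by linarith) (show 1 - c < 1 by linarith)
  refine ⟨t * N, fun J _ hJ E hE w w1 hw => ?_⟩
  have := C1_aux r d (β := β/2) (by linarith) N hN hc0 (by linarith) hc t J hJ E hE w w1 hw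
  have hE0 : 0 ≤ ex (fun z => ind (E z)) := ex_nonneg (fun _ => ind_nonneg _)
  have hE1 : ex (fun z => ind (E z)) ≤ 1 := ex_le (fun _ => ind_le_one _)
  nlinarith

theorem Q_aux {α : Type} [Finite α] (hD : ∀ δ, 0 < δ → D α δ) (S : Finset α) :
    ∀ (d : ℕ) (β : ℝ), 0 < β →
    ∃ M : ℕ, ∀ (J : Type) [Finite J], M ≤ Nat.card J → ∀ E : α → (J → Option α) → Prop,
      (∀ r ∈ S, Insens r (E r)) →
      ∀ w : (J → Option α) → ℝ, (∀ z, w z ≤ 1) →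
      (∀ V : J → Option α ⊕ Fin d, Proper V → ex (fun v => w (sub V v)) ≤ 0) →
      ex (fun z => ind (∀ r ∈ S, E r z) * w z) ≤ β := by
  classical
  induction S using Finset.induction_on with
  | empty =>
    intro d β hβ
    refine ⟨d, fun J _ hJ E _ w _ hw => ?_⟩
    obtain ⟨J', _, e, _⟩ := split (J := J) (I := Fin d) (by rwa [Nat.card_fin])
    have h0 : ex (fun z => ind (∀ r ∈ (∅ : Finset α), E r z) * w z) = ex w := by
      congr 1; funext z; rw [ind_true (by simp), one_mul]
    rw [h0, ex_mk' e]
    refine (ex_le fun y => ?_).trans hβ.le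
    have := hw (mk e (fun i => Sum.inr i) (fun j => Sum.inl (y j)))
      (Proper.mkl _ _ (fun i => ⟨i, rfl⟩))
    simpa only [sub_mk, sub_inl, sub_inr] using this
  | insert a S ha ih =>
    intro d β hβ
    obtain ⟨d1, hd1⟩ := ih d (β/2) (by linarith)
    obtain ⟨M, hM⟩ := C1 hD a d1 (β := β/2) (by linarith)
    refine ⟨M, fun J _ hJ E hE w w1 hw => ?_⟩
    have key := hM J hJ (E a) (hE a (mem_insert_self _ _))
      (fun z => ind (∀ r ∈ S, E r z) * w z - β/2) ?_ ?_
    · have h1 : ∀ z, ind (∀ r ∈ insert a S, E r z) * w z =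
          ind (E a z) * (ind (∀ r ∈ S, E r z) * w z - β/2) + (β/2) * ind (E a z) := by
        intro z
        rw [forall_mem_insert, ind_and]; ring
      simp only [h1]
      rw [ex_add, ex_mul]
      have hE1 : ex (fun z => ind (E a z)) ≤ 1 := ex_le (fun _ => ind_le_one _)
      nlinarith
    · intro z
      have h1 := ind_nonneg (∀ r ∈ S, E r z)
      have h2 := ind_le_one (∀ r ∈ S, E r z)
      nlinarith [w1 z]
    · intro V hV
      rw [ex_sub, ex_const]
      have := hd1 (Fin d1) (by simp) (fun r z => E r (sub V z))
        (fun r hr => (hE r (mem_insert_of_mem hr)).pull V) (fun z => w (sub V z)) (fun _ => w1 _)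
        (fun W hW => by
          have := hw (comp V W) (hV.comp hW)
          simpa only [sub_comp] using this)
      linarith

theorem Q {α : Type} [Finite α] (hD : ∀ δ, 0 < δ → D α δ) (d : ℕ) {β : ℝ} (hβ : 0 < β) :
    ∃ M : ℕ, ∀ (J : Type) [Finite J], M ≤ Nat.card J → ∀ E : α → (J → Option α) → Prop,
      (∀ r, Insens r (E r)) →
      ∀ w : (J → Option α) → ℝ, (∀ z, w z ≤ 1) →
      (∀ V : J → Option α ⊕ Fin d, Proper V → ex (fun v => w (sub V v)) ≤ 0) →
      ex (fun z => ind (∀ r, E r z) * w z) ≤ β := by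
  let _ := Fintype.ofFinite α
  obtain ⟨M, hM⟩ := Q_aux hD univ d β hβ
  refine ⟨M, fun J _ hJ E hE w w1 hw => ?_⟩
  have := hM J hJ E (fun r _ => hE r) w w1 hw
  simpa using this

def cons {J α : Type} (a : Option α) (z : J → Option α) : Option J → Option α := fun o => o.elim a z

theorem Ram {α : Type} [Finite α] [Nonempty α] (m N0 : ℕ) : ∀ (U : Type) [Finite U],
    ∃ (I : Type) (_ : Finite I), m ≤ Nat.card I ∧ ∀ Good : U → (I → Option α) → Prop,
      (∃ f : I → α ⊕ Fin N0, Proper f ∧ ∀ l : Fin N0 → Option α, (∃ e, l e = none) →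
        ∀ u, ¬ Good u (sub (lift f) l)) ∨
      (∃ (u : U) (J : Type) (_ : Finite J), m ≤ Nat.card J ∧ ∃ g : I → α ⊕ Option J, Proper g ∧
        ∀ z : J → Option α, Good u (sub (lift g) (cons none z))) := by
  induction N0 with
  | zero =>
    intro U _
    refine ⟨Fin m, inferInstance, by simp, fun Good => Or.inl ?_⟩
    exact ⟨fun _ => Sum.inl (Classical.arbitrary α), fun e => e.elim0, fun l ⟨e, _⟩ => e.elim0⟩
  | succ N0 ih =>
    intro U _
    obtain ⟨I2, _, hI2, ih⟩ := ih (U × α)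
    obtain ⟨I1, _, hI1⟩ := Combinatorics.Subspace.exists_mono_in_high_dimension (Option α) (U → Prop) I2
    refine ⟨Option I1, inferInstance, ?_, fun Good => ?_⟩
    · obtain ⟨l, _⟩ := hI1 (fun _ _ => True)
      choose p hp using l.proper
      have hinj : Function.Injective (fun e => some (p e)) := by
        intro a b h
        have h : p a = p b := Option.some.inj h
        have h1 := hp a
        rw [h, hp b] at h1
        exact (Sum.inr.inj h1).symm
      exact hI2.trans (Nat.card_le_card_of_injective _ hinj)
    obtain ⟨l, c, hl⟩ := hI1 (fun z u => Good u (cons none z))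
    set g : Option I1 → α ⊕ Option I2 := fun o => o.elim (Sum.inr none) (fun i =>
      (l.idxFun i).elim (fun a => a.elim (Sum.inr none) Sum.inl) (fun e => Sum.inr (some e))) with hg
    have hgp : Proper g := by
      intro e
      cases e with
      | none => exact ⟨none, rfl⟩
      | some e =>
        obtain ⟨i, hi⟩ := l.proper e
        exact ⟨some i, by simp [hg, hi]⟩
    have hgl : ∀ z, sub (lift g) (cons none z) = cons none (l z) := by
      intro z
      funext o
      cases o with
      | none => rfl
      | some i =>
        simp only [sub, lift, hg, cons, Option.elim, Combinatorics.Subspace.apply_def]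
        rcases h : l.idxFun i with (_ | a) | e <;> simp [cons]
    by_cases hc : ∃ u, c u
    · obtain ⟨u, hu⟩ := hc
      refine Or.inr ⟨u, I2, inferInstance, hI2, g, hgp, fun z => ?_⟩
      rw [hgl]
      have := congrFun (hl z) u
      simp only at this
      rwa [this]
    · push Not at hc
      have hbad : ∀ u z, ¬ Good u (sub (lift g) (cons none z)) := by
        intro u z
        rw [hgl]
        have := congrFun (hl z) u
        simp only at this
        rw [this]
        exact hc u
      rcases ih (fun p z => Good p.1 (sub (lift g) (cons (some p.2) z))) with
        ⟨f, hf, hfl⟩ | ⟨⟨u, a⟩, J, hJ, hJm, g2, hg2, hg2z⟩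
      · left
        refine ⟨comp g (fun o => o.elim (Sum.inr 0) (fun e => (f e).map id Fin.succ)), hgp.comp ?_, ?_⟩
        · intro e
          refine Fin.cases ⟨none, rfl⟩ (fun b => ?_) e
          obtain ⟨i, hi⟩ := hf b
          exact ⟨some i, by simp [hi]⟩
        · intro l' hl' u
          rw [lift_comp, sub_comp]
          have h1 : sub (lift (fun o : Option I2 => o.elim (Sum.inr 0) (fun e => (f e).map id Fin.succ))) l'
              = cons (l' 0) (sub (lift f) (fun b => l' b.succ)) := by
            funext o
            cases o with
            | none => rfl
            | some i =>
              simp only [sub, lift, cons, Option.elim]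
              rcases h : f i with _ | e <;> simp
          rw [h1]
          rcases h0 : l' 0 with _ | a
          · exact hbad u _
          · refine hfl _ ?_ (u, a)
            obtain ⟨e, he⟩ := hl'
            revert he
            refine Fin.cases (fun he => ?_) (fun b he => ⟨b, he⟩) e
            rw [h0] at he
            cases he
      · right
        refine ⟨u, J, hJ, hJm, comp g (fun o => o.elim (Sum.inl a) g2), hgp.comp ?_, ?_⟩
        · intro e
          obtain ⟨i, hi⟩ := hg2 e
          exact ⟨some i, hi⟩
        · intro z
          rw [lift_comp, sub_comp]
          convert hg2z z using 2
          funext o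
          cases o with
          | none => rfl
          | some i =>
            simp only [sub, lift, cons, Option.elim]

end DHJ


namespace DHJ
open Finset

theorem telescoping {α J : Type} [Finite α] [Finite J] {β : ℝ} (E : α → (J → Option α) → Prop)
    (hE : ∀ r, Insens r (E r)) (w : (J → Option α) → ℝ)
    (hQ : ∀ E : α → (J → Option α) → Prop, (∀ r, Insens r (E r)) →
      ex (fun z => ind (∀ r, E r z) * w z) ≤ β) (S : Finset α) :
    ex (fun z => (1 - ind (∀ r ∈ S, E r z)) * w z) ≤ #S * β := by
  classical
  induction S using Finset.induction_on with
  | empty =>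
    have : ∀ z, (1 - ind (∀ r ∈ (∅ : Finset α), E r z)) * w z = 0 := by
      intro z; rw [ind_true (by simp)]; ring
    simp only [this, ex_const]
    simp
  | insert a S ha ih =>
    have h1 := hQ (fun r z => if r = a then ¬ E a z else if r ∈ S then E r z else True) (by
      intro r
      by_cases hr : r = a
      · subst hr
        simp only [if_true]
        exact (hE r).not
      · by_cases hrS : r ∈ S
        · simp only [if_neg hr, if_pos hrS]; exact hE r
        · simp only [if_neg hr, if_neg hrS]; exact fun _ _ _ => Iff.rfl)
    have h2 : ∀ z, (1 - ind (∀ r ∈ insert a S, E r z)) * w z =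
        (1 - ind (∀ r ∈ S, E r z)) * w z +
        ind (∀ r, if r = a then ¬ E a z else if r ∈ S then E r z else True) * w z := by
      intro z
      have h3 : (∀ r, if r = a then ¬ E a z else if r ∈ S then E r z else True) ↔
          (¬ E a z ∧ ∀ r ∈ S, E r z) := by
        constructor
        · intro h
          refine ⟨by simpa using h a, fun r hr => ?_⟩
          have := h r
          rw [if_neg (fun h : r = a => ha (h ▸ hr)), if_pos hr] at this
          exact this
        · rintro ⟨h, h'⟩ r
          split_ifs with h1 h2
          · exact h
          · exact h' r h2
      rw [ind_congr h3, forall_mem_insert, ind_and, ind_and, ind_not]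
      ring
    simp only [h2, ex_add]
    rw [card_insert_of_notMem ha]
    push_cast
    linarith

theorem mainStep {α : Type} [Finite α] [Nonempty α] (hD : ∀ δ, 0 < δ → D α δ) {δ0 : ℝ}
    (hδ0 : 0 < δ0) (hδ1 : δ0 ≤ 1) :
    ∃ γ > 0, ∀ δ, δ0 ≤ δ → D (Option α) (δ + γ) → D (Option α) δ := by
  obtain ⟨N0, hN0⟩ := hD (δ0/4) (by linarith)
  obtain ⟨θ, hθ⟩ : ∃ θ : ℝ, θ = δ0 / 4 / Nat.card (Fin N0 → Option α) := ⟨_, rfl⟩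
  have hF : (1:ℝ) ≤ Nat.card (Fin N0 → Option α) := by exact_mod_cast Nat.card_pos
  have hk : (0:ℝ) < Nat.card α := card_pos' α
  have hθ0 : 0 < θ := by rw [hθ]; positivity
  have hθ1 : θ ≤ 1 := by
    rw [hθ]
    apply div_le_of_le_mul₀ (by positivity) (by norm_num)
    linarith
  obtain ⟨ε, hε⟩ : ∃ ε : ℝ, ε = δ0 * θ / 4 := ⟨_, rfl⟩
  have hε0 : 0 < ε := by rw [hε]; positivity
  refine ⟨ε, hε0, fun δ hδ hDβ => ?_⟩
  obtain ⟨d, hd⟩ := hDβ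
  obtain ⟨m, hm⟩ := Q hD d (β := ε / Nat.card α) (by positivity)
  obtain ⟨I, _, hI, hRam⟩ := Ram (α := α) m N0 Unit
  obtain ⟨N, hN⟩ := lemmaA (Option α) I hε0
  refine ⟨N, fun J _ hJ A hA => ?_⟩
  obtain ⟨Y, _, _, g, hg, hgx⟩ := hN J hJ (fun z => ind (A z)) (fun _ => ind_le_one _)
    (fun _ => ind_nonneg _)
  replace hgx : ∀ x, δ - ε ≤ ex (fun y => ind (A (sub (g y) x))) := fun x => by linarith [hgx x]
  clear hA
  by_contra hline
  have hline' : ∀ y, ¬ HasLine (fun x => A (sub (g y) x)) := fun y h => hline (h.pull (hg y))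
  rcases hRam (fun _ l => θ ≤ ex (fun y => ind (∀ r : α, A (sub (g y) (fun i => some ((l i).getD r))))))
    with ⟨f, hf, hfl⟩ | ⟨-, J2, _, hJ2, g2, hg2, hgood⟩
  · -- first case
    have h1 : δ0/2 ≤ ex (fun x : Fin N0 → α => ex (fun y => ind (A (sub (g y) (fun i => some (sub f x i)))))) := by
      refine le_ex fun x => ?_
      have := hgx (fun i => some (sub f x i))
      have : ε ≤ δ0 / 2 := by rw [hε]; nlinarith
      linarith
    rw [ex_comm] at h1
    have h2 := fiber (fun y => ex_le (fun x => ind_le_one _)) (by linarith) h1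
    obtain ⟨l, hl⟩ := pigeon _ (fun (l : Fin N0 → Option α) y => (∃ i, l i = none) ∧
        ∀ r, A (sub (g y) (fun i => some (sub f (fun e => (l e).getD r) i))))
      (fun y hy => hN0 (Fin N0) (by simp) (fun x => A (sub (g y) (fun i => some (sub f x i))))
        (by linarith)) (by linarith) h2
    have hpos : δ0 / 2 / 2 / (Nat.card (Fin N0 → Option α) : ℝ) = θ := by rw [hθ]; ring
    rw [hpos] at hl
    obtain ⟨_, hnone, _⟩ := exists_of_ex_ind_pos (lt_of_lt_of_le hθ0 hl)
    refine hfl l hnone () (hl.trans (ex_mono fun y => ind_mono fun h => ?_))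
    intro r
    convert h.2 r using 3 with i
    unfold sub lift
    cases h : f i <;> simp [h]
  · -- second case
    set wd : (J2 → Option α) → I → Option α := fun z => sub (lift g2) (cons none z) with hwd
    set Dy : Y → α → (J2 → Option α) → Prop :=
      fun y r z => A (sub (g y) (fun i => some ((wd z i).getD r))) with hDy
    have h1 : θ ≤ ex (fun y => ex (fun z : J2 → Option α => ind (∀ r, Dy y r z))) := by
      rw [ex_comm]
      exact le_ex hgood
    have h2 : δ - ε ≤ ex (fun y => ex (fun z : J2 → Option α => ind (A (sub (g y) (wd z))))) := by
      rw [ex_comm]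
      exact le_ex (fun z => hgx _)
    have hδp : 0 < δ := by linarith
    have h3 : δ - ε + δ * θ ≤ ex (fun y => ex (fun z : J2 → Option α => ind (A (sub (g y) (wd z)))) +
        δ * ex (fun z : J2 → Option α => ind (∀ r, Dy y r z))) := by
      rw [ex_add, ex_mul]
      have := mul_le_mul_of_nonneg_left h1 hδp.le
      linarith
    obtain ⟨y, hy⟩ := exists_ge h3
    have hins : ∀ r, Insens r (Dy y r) := by
      intro r z z' hz
      have : (fun i => some ((wd z i).getD r)) = (fun i => some ((wd z' i).getD r)) := by
        funext i
        simp only [hwd, sub, lift]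
        rcases h : g2 i with a | (_ | e) <;> simp [cons, hz]
      simp only [hDy, this]
    have hdisj : ∀ z, (∀ r, Dy y r z) → ¬ A (sub (g y) (wd z)) := by
      intro z hz hA
      apply hline' y
      refine ⟨fun i => (wd z i).map some, ?_, ?_⟩
      · obtain ⟨i, hi⟩ := hg2 none
        exact ⟨i, by simp [hwd, sub, lift, hi, cons]⟩
      · intro r
        cases r with
        | none =>
          convert hA using 2
          funext i
          cases h : wd z i <;> simp [h]
        | some r =>
          convert hz r using 2
          funext i
          cases h : wd z i <;> simp [h]
    set K : I → Option α ⊕ J2 := fun i => (g2 i).elim (fun a => Sum.inl (some a))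
      (fun o => o.elim (Sum.inl none) Sum.inr) with hK
    have hKp : Proper K := by
      intro e
      obtain ⟨i, hi⟩ := hg2 (some e)
      exact ⟨i, by simp [hK, hi]⟩
    have hKs : ∀ z, sub K z = wd z := by
      intro z
      funext i
      simp only [hwd, sub, lift, hK]
      rcases h : g2 i with a | (_ | e) <;> simp [cons]
    have hε1 : ∀ z : J2 → Option α, ind (A (sub (g y) (wd z))) - (δ + ε) ≤ 1 := fun z => by
      have := ind_le_one (A (sub (g y) (wd z)))
      linarith
    have hQ := fun E hE => hm J2 hJ2 E hE (fun z => ind (A (sub (g y) (wd z))) - (δ + ε)) hε1 (by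
      intro V hV
      rw [ex_sub, ex_const]
      by_contra hc
      push Not at hc
      have h5 := hd (Fin d) (by simp) (fun v => A (sub (g y) (wd (sub V v)))) (by linarith)
      have h6 : HasLine (fun z => A (sub (g y) (wd z))) := HasLine.pull (A := fun z => A (sub (g y) (wd z))) hV h5
      simp only [← hKs] at h6
      exact hline' y (HasLine.pull (A := fun z => A (sub (g y) z)) hKp h6))
    let _ := Fintype.ofFinite α
    have h7 := telescoping (Dy y) hins _ hQ univ
    have h8 : ∀ z, (1 - ind (∀ r ∈ univ, Dy y r z)) * (ind (A (sub (g y) (wd z))) - (δ + ε)) =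
        (ind (A (sub (g y) (wd z))) - (δ + ε)) + (δ + ε) * ind (∀ r, Dy y r z) := by
      intro z
      have : (∀ r ∈ univ, Dy y r z) ↔ ∀ r, Dy y r z := by simp
      rw [ind_congr this]
      by_cases hz : ∀ r, Dy y r z
      · rw [ind_true hz, ind_false (hdisj z hz)]; ring
      · rw [ind_false hz]; ring
    simp only [h8] at h7
    rw [ex_add, ex_sub, ex_const, ex_mul, card_univ, ← Nat.card_eq_fintype_card,
      mul_div_cancel₀ _ hk.ne'] at h7
    have h9 : 0 ≤ ex (fun z : J2 → Option α => ind (∀ r, Dy y r z)) := ex_nonneg (fun _ => ind_nonneg _)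
    have h10 : δ0 * θ ≤ δ * θ := by gcongr
    have h11 : 0 < δ0 * θ := by positivity
    nlinarith

theorem D_option {α : Type} [Finite α] [Nonempty α] (hD : ∀ δ, 0 < δ → D α δ) :
    ∀ δ, 0 < δ → D (Option α) δ := by
  intro δ hδ
  obtain ⟨γ, hγ, h⟩ := mainStep hD (δ0 := min δ 1) (by positivity) (min_le_right _ _)
  have key : ∀ n : ℕ, ∀ δ', min δ 1 ≤ δ' → 1 < δ' + n * γ → D (Option α) δ' := by
    intro n
    induction n with
    | zero =>
      intro δ' _ h1
      refine ⟨0, fun J _ _ A hA => ?_⟩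
      have : ex (fun x => ind (A x)) ≤ 1 := ex_le (fun _ => ind_le_one _)
      simp at h1
      linarith
    | succ n ih =>
      intro δ' h0 h1
      refine h δ' h0 (ih _ (by linarith) ?_)
      push_cast at h1
      linarith
  obtain ⟨n, hn⟩ := exists_nat_gt (1 / γ)
  rw [div_lt_iff₀ hγ] at hn
  exact key n δ (min_le_left _ _) (by linarith)

theorem D_exists (n : ℕ) : ∃ (α : Type) (_ : Finite α), Nonempty α ∧ Nat.card α = n + 1 ∧
    ∀ δ, 0 < δ → D α δ := by
  induction n with
  | zero =>
    refine ⟨Unit, inferInstance, inferInstance, by simp, fun δ hδ => ⟨1, fun J _ hJ A hA => ?_⟩⟩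
    obtain ⟨x, hx⟩ := exists_of_ex_ind_pos (lt_of_lt_of_le hδ hA)
    have : Nonempty J := (Nat.card_pos_iff.mp (by omega)).1
    refine ⟨fun _ => none, ⟨this.some, rfl⟩, fun r => ?_⟩
    convert hx
  | succ n ih =>
    obtain ⟨α, _, _, hc, hD⟩ := ih
    exact ⟨Option α, inferInstance, inferInstance, by rw [Finite.card_option, hc], D_option hD⟩

/-- Szemerédi in `ZMod q`. -/
theorem szemeredi (L : ℕ) {δ : ℝ} (hδ : 0 < δ) : ∃ q₀ : ℕ, ∀ q : ℕ, q.Prime → q₀ ≤ q →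
    ∀ B : Set (ZMod q), δ * q ≤ Nat.card ↥B →
    ∃ x d : ZMod q, d ≠ 0 ∧ ∀ i : ℕ, i ≤ L → x + (i : ZMod q) * d ∈ B := by
  classical
  obtain ⟨α, _, _, hc, hD⟩ := D_exists L
  obtain ⟨N, hN⟩ := hD δ hδ
  have e : α ≃ Fin (L + 1) := (Finite.equivFin α).trans (finCongr hc)
  refine ⟨N + 1, fun q hq hqN B hB => ?_⟩
  have : NeZero q := ⟨hq.ne_zero⟩
  have hBd : δ ≤ ex (fun a : ZMod q => ind (a ∈ B)) := by
    rw [ex_eq, le_div_iff₀ (card_pos' _), Nat.card_zmod]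
    refine hB.trans (le_of_eq ?_)
    unfold ind
    rw [Finset.sum_boole, Nat.card_eq_fintype_card, Fintype.card_subtype]
  let s : (Fin N → α) → ZMod q := fun x => ∑ i, ((e (x i) : ℕ) : ZMod q)
  have h1 : δ ≤ ex (fun x : Fin N → α => ex (fun a : ZMod q => ind (a + s x ∈ B))) := by
    refine le_ex fun x => ?_
    have := ex_equiv (Equiv.addRight (s x)) (fun a => ind (a ∈ B))
    simp only [Equiv.coe_addRight] at this
    rw [this]; exact hBd
  rw [ex_comm] at h1
  obtain ⟨a, ha⟩ := exists_ge h1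
  obtain ⟨l, ⟨i0, hi0⟩, hl⟩ := hN (Fin N) (by simp) (fun x => a + s x ∈ B) ha
  set W : Finset (Fin N) := univ.filter (fun i => l i = none) with hW
  refine ⟨a + ∑ i ∈ Wᶜ, (((l i).elim 0 (fun r => (e r : ℕ)) : ℕ) : ZMod q), (#W : ZMod q), ?_, ?_⟩
  · intro h0
    rw [ZMod.natCast_eq_zero_iff] at h0
    have h2 : 0 < #W := card_pos.mpr ⟨i0, by simp [hW, hi0]⟩
    have h3 : #W ≤ N := by simpa using card_le_univ W
    have := Nat.le_of_dvd h2 h0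
    omega
  · intro i hi
    have h4 := hl (e.symm ⟨i, by omega⟩)
    convert h4 using 1
    simp only [s]
    rw [add_assoc]
    congr 1
    rw [← sum_add_sum_compl W, add_comm]
    congr 1
    · rw [sum_congr rfl (g := fun _ => (i : ZMod q))]
      · simp [mul_comm]
      · intro j hj
        rw [hW, mem_filter] at hj
        simp [hj.2]
    · refine sum_congr rfl fun j hj => ?_
      rw [mem_compl, hW, mem_filter] at hj
      rcases h : l j with _ | r
      · exact absurd ⟨mem_univ _, h⟩ hj
      · simp

end DHJ


namespace Zpart
open Finset

def Ext (k : ℤ) (R : Set ℤ) : Prop :=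
  ∀ a ∈ R, ∀ b ∈ R, ∃ t : ℤ, 1 ≤ t ∧ t ≤ k ∧ b + t * (b - a) ∈ R

open Classical in
noncomputable def Rf (R : Set ℤ) (H : ℤ) : Finset ℤ := (Finset.Icc 0 H).filter (· ∈ R)

theorem mem_Rf {R : Set ℤ} {H x : ℤ} : x ∈ Rf R H ↔ 0 ≤ x ∧ x ≤ H ∧ x ∈ R := by
  simp [Rf, and_assoc]

theorem count_step {k : ℤ} (hk : 1 ≤ k) {R : Set ℤ} (hext : Ext k R) {G H s : ℤ}
    (hs : k * s ≤ G) (hH : G ≤ H) : (#(Rf R (H + s)) : ℤ) ≤ (k + 1) * #(Rf R H) + 1 := by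
  classical
  set new := (Rf R (H + s)).filter (fun x => H < x) with hnew
  have hsplit : Rf R (H + s) ⊆ Rf R H ∪ new := by
    intro x hx
    rw [mem_union, hnew, mem_filter]
    by_cases h : H < x
    · exact Or.inr ⟨hx, h⟩
    · rw [mem_Rf] at hx ⊢
      exact Or.inl ⟨hx.1, by omega, hx.2.2⟩
  have h1 : #(Rf R (H+s)) ≤ #(Rf R H) + #new := (card_le_card hsplit).trans (card_union_le _ _)
  have h2 : (#new : ℤ) ≤ k * #(Rf R H) + 1 := by
    by_cases hne : new.Nonempty
    · set ρ := new.min' hne with hρ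
      have hρm : ρ ∈ new := min'_mem _ _
      have hρm' := hρm
      rw [hnew, mem_filter, mem_Rf] at hρm'
      obtain ⟨⟨p1, p2, p3⟩, p4⟩ := hρm'
      have key : ∀ x ∈ new.erase ρ, ∃ t : ℤ, (1 ≤ t ∧ t ≤ k) ∧ ρ + t * (ρ - x) ∈ Rf R H := by
        intro x hx
        obtain ⟨hxne, hx⟩ := mem_erase.mp hx
        have hle : ρ ≤ x := min'_le _ _ hx
        rw [hnew, mem_filter, mem_Rf] at hx
        obtain ⟨⟨q1, q2, q3⟩, q4⟩ := hx
        obtain ⟨t, t1, t2, t3⟩ := hext x q3 ρ p3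
        refine ⟨t, ⟨t1, t2⟩, ?_⟩
        have hlt : ρ < x := lt_of_le_of_ne hle (Ne.symm hxne)
        have b1 : t * (x - ρ) ≤ k * s := by
          apply mul_le_mul t2 (by omega) (by omega) (by omega)
        have b2 : 1 * 1 ≤ t * (x - ρ) := by
          apply mul_le_mul t1 (by omega) (by omega) (by omega)
        have b3 : t * (ρ - x) = - (t * (x - ρ)) := by ring
        rw [mem_Rf]
        refine ⟨by omega, ?_, t3⟩
        by_contra hc
        have : ρ + t * (ρ - x) ∈ new := by
          rw [hnew, mem_filter, mem_Rf]
          exact ⟨⟨by omega, by omega, t3⟩, by omega⟩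
        have := min'_le _ _ this
        omega
      choose! t ht1 ht2 using key
      have hcard : #(new.erase ρ) ≤ #((Finset.Icc 1 k) ×ˢ Rf R H) := by
        apply card_le_card_of_injOn (fun x => (t x, ρ + t x * (ρ - x)))
        · intro x hx
          have h := ht1 x hx
          exact mem_coe.mpr (mem_product.mpr ⟨Finset.mem_Icc.mpr h, ht2 x hx⟩)
        · intro x hx y hy hxy
          simp only [Prod.mk.injEq] at hxy
          obtain ⟨e1, e2⟩ := hxy
          have h := (ht1 x hx).1
          rw [← e1] at e2
          have : t x * (ρ - x) = t x * (ρ - y) := by linarith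
          have := mul_left_cancel₀ (by omega) this
          linarith
      rw [card_product, Int.card_Icc, card_erase_of_mem hρm] at hcard
      have hpos : 0 < #new := card_pos.mpr hne
      have h3 : ((k + 1 - 1).toNat : ℤ) = k := by rw [Int.toNat_of_nonneg] <;> omega
      have h4 : ((#new - 1 : ℕ) : ℤ) ≤ (((k + 1 - 1).toNat * #(Rf R H) : ℕ) : ℤ) := by exact_mod_cast hcard
      rw [Nat.cast_mul, h3] at h4
      omega
    · rw [not_nonempty_iff_eq_empty] at hne
      rw [hne]
      simp only [card_empty]
      positivity
  have h3 : (#(Rf R (H+s)) : ℤ) ≤ #(Rf R H) + #new := by exact_mod_cast h1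
  linarith

theorem count_bound {k : ℤ} (hk : 1 ≤ k) (K : ℤ) (hK : 0 ≤ K) : ∃ n0 : ℕ, ∀ (G : ℤ), 2 * k ≤ G → ∀ (R : Set ℤ),
    Ext k R → (∀ n, 1 ≤ n → n < G → n ∉ R) → #(Rf R (K * G)) ≤ n0 := by
  have h : ∀ i : ℕ, ∃ n0 : ℕ, ∀ (G : ℤ), 2 * k ≤ G → ∀ (R : Set ℤ),
    Ext k R → (∀ n, 1 ≤ n → n < G → n ∉ R) → #(Rf R (G + i * (G / k))) ≤ n0 := by
    intro i
    induction i with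
    | zero =>
      refine ⟨2, fun G hG R _ hgap => ?_⟩
      have : Rf R (G + (0:ℕ) * (G/k)) ⊆ {0, G} := by
        intro x hx
        rw [mem_Rf] at hx
        simp only [mem_insert, mem_singleton]
        by_contra hc
        push Not at hc
        refine hgap x ?_ ?_ hx.2.2
        · have := hc.1; omega
        · have h1 := hc.2
          have h2 := hx.2.1
          simp at h2
          omega
      exact (card_le_card this).trans card_le_two
    | succ i ih =>
      obtain ⟨n, hn⟩ := ih
      refine ⟨((k + 1) * n + 1).toNat, fun G hG R hext hgap => ?_⟩
      have h0 : 0 ≤ G / k := Int.ediv_nonneg (by omega) (by omega)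
      have h00 : G ≤ G + i * (G / k) := by
        have : 0 ≤ (i : ℤ) * (G / k) := by positivity
        linarith
      have h1 := count_step hk hext (G := G) (H := G + i * (G / k)) (s := G / k)
        (Int.mul_ediv_self_le (by omega)) h00
      have h2 := hn G hG R hext hgap
      have h3 : G + ((i + 1 : ℕ) : ℤ) * (G / k) = G + i * (G / k) + G / k := by push_cast; ring
      rw [h3]
      zify
      have h4 : (k + 1) * (#(Rf R (G + i * (G / k))) : ℤ) ≤ (k+1) * n := by
        apply mul_le_mul_of_nonneg_left _ (by omega); exact_mod_cast h2
      have := Int.self_le_toNat ((k + 1) * n + 1)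
      linarith
  obtain ⟨n, hn⟩ := h (2 * k * K).toNat
  refine ⟨n, fun G hG R hext hgap => (card_le_card ?_).trans (hn G hG R hext hgap)⟩
  intro x hx
  rw [mem_Rf] at hx ⊢
  refine ⟨hx.1, hx.2.1.trans ?_, hx.2.2⟩
  rw [Int.toNat_of_nonneg (by positivity)]
  have h1 : G - k < k * (G / k) := by
    have := Int.emod_add_mul_ediv G k
    have := Int.emod_lt_of_pos G (show 0 < k by omega)
    linarith
  have h2 : G ≤ 2 * (k * (G / k)) := by linarith
  have h3 := mul_le_mul_of_nonneg_left h2 hK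
  nlinarith

theorem collinear {k : ℤ} (hk : 1 ≤ k) {R : Set ℤ} (hext : Ext k R) {G v : ℤ} (hG : 0 < G) (hv : 2 * k * G ≤ v)
    (h0 : 0 ∈ R) (hvR : v ∈ R) (hwin : ∀ x, ∃ i, 0 ≤ i ∧ i < G ∧ x + i ∈ R)
    (f : ℤ → ℤ) (f0 : f 0 = 0) (fv : f v = 0)
    (hf : ∀ a ∈ Rf R v, ∀ b ∈ Rf R v, ∀ t, 1 ≤ t → t ≤ k → b + t * (b - a) ∈ Rf R v →
      f (b + t * (b - a)) = f b + t * (f b - f a)) : ∀ r ∈ Rf R v, f r ≤ 0 := by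
  classical
  intro r hr
  by_contra hpos
  push Not at hpos
  obtain ⟨M, hM, hmax⟩ := exists_max_image (Rf R v) f ⟨r, hr⟩
  have hMpos : 0 < f M := lt_of_lt_of_le hpos (hmax r hr)
  set S := (Rf R v).filter (fun x => f x = f M) with hS
  have hSne : S.Nonempty := ⟨M, by simp [hS, hM]⟩
  have hkG : k * G ≤ v := by nlinarith
  -- rightmost
  have hR : S.max' hSne < k * G := by
    set a := S.max' hSne with ha
    have haS : a ∈ S := max'_mem _ _
    have haS' := haS
    rw [hS, mem_filter] at haS'
    obtain ⟨haT, hfa⟩ := haS'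
    have haT' := mem_Rf.mp haT
    have hav : a < v := by
      rcases lt_or_eq_of_le haT'.2.1 with h | h
      · exact h
      · rw [h, fv] at hfa; omega
    obtain ⟨b, hb1, hb2, hb3⟩ : ∃ b, a < b ∧ b ≤ a + G ∧ b ∈ Rf R v := by
      obtain ⟨i, i0, i1, i2⟩ := hwin (a + 1)
      by_cases h : a + 1 + i ≤ v
      · exact ⟨a + 1 + i, by omega, by omega, mem_Rf.mpr ⟨by omega, h, i2⟩⟩
      · exact ⟨v, hav, by omega, mem_Rf.mpr ⟨by omega, le_rfl, hvR⟩⟩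
    have hfb : f b < f M := by
      refine lt_of_le_of_ne (hmax b hb3) fun h => ?_
      have : b ∈ S := by rw [hS, mem_filter]; exact ⟨hb3, h⟩
      have := le_max' S b this
      omega
    by_contra hc
    push Not at hc
    obtain ⟨t, t1, t2, t3⟩ := hext b (mem_Rf.mp hb3).2.2 a haT'.2.2
    have b1 : t * (b - a) ≤ k * G := mul_le_mul t2 (by omega) (by omega) (by omega)
    have b2 : 1 * 1 ≤ t * (b - a) := mul_le_mul t1 (by omega) (by omega) (by omega)
    have b3 : t * (a - b) = - (t * (b - a)) := by ring
    have hcT : a + t * (a - b) ∈ Rf R v := mem_Rf.mpr ⟨by omega, by omega, t3⟩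
    have := hf b hb3 a haT t t1 t2 hcT
    have := hmax _ hcT
    nlinarith
  have hL : v - k * G < S.min' hSne := by
    set a := S.min' hSne with ha
    have haS : a ∈ S := min'_mem _ _
    have haS' := haS
    rw [hS, mem_filter] at haS'
    obtain ⟨haT, hfa⟩ := haS'
    have haT' := mem_Rf.mp haT
    have hav : 0 < a := by
      rcases lt_or_eq_of_le haT'.1 with h | h
      · exact h
      · rw [← h, f0] at hfa; omega
    obtain ⟨b, hb1, hb2, hb3⟩ : ∃ b, b < a ∧ a - G ≤ b ∧ b ∈ Rf R v := by
      obtain ⟨i, i0, i1, i2⟩ := hwin (a - G)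
      by_cases h : 0 ≤ a - G + i
      · exact ⟨a - G + i, by omega, by omega, mem_Rf.mpr ⟨by omega, by omega, i2⟩⟩
      · exact ⟨0, hav, by omega, mem_Rf.mpr ⟨by omega, by omega, h0⟩⟩
    have hfb : f b < f M := by
      refine lt_of_le_of_ne (hmax b hb3) fun h => ?_
      have : b ∈ S := by rw [hS, mem_filter]; exact ⟨hb3, h⟩
      have := min'_le S b this
      omega
    by_contra hc
    push Not at hc
    obtain ⟨t, t1, t2, t3⟩ := hext b (mem_Rf.mp hb3).2.2 a haT'.2.2
    have b1 : t * (a - b) ≤ k * G := mul_le_mul t2 (by omega) (by omega) (by omega)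
    have b2 : 1 * 1 ≤ t * (a - b) := mul_le_mul t1 (by omega) (by omega) (by omega)
    have hcT : a + t * (a - b) ∈ Rf R v := mem_Rf.mpr ⟨by omega, by omega, t3⟩
    have := hf b hb3 a haT t t1 t2 hcT
    have := hmax _ hcT
    nlinarith
  have := min'_le_max' S hSne
  nlinarith

theorem dirichlet {k : ℤ} (hk : 1 ≤ k) {R : Set ℤ} {G V : ℤ} (hG : 0 < G) :
    ∃ (j : ℤ) (f : ℤ → ℤ), 1 ≤ j ∧ j ≤ (2 * k.toNat + 2) ^ #(Rf R V) ∧ f 0 = 0 ∧ f G = 0 ∧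
      (∀ r, G ∣ j * r - f r) ∧ ∀ r ∈ Rf R V, |f r| * (2 * k + 2) < G := by
  set Mm : ℕ := 2 * k.toNat + 2 with hMm
  have hMm' : (Mm : ℤ) = 2 * k + 2 := by rw [hMm]; push_cast; rw [Int.toNat_of_nonneg (by omega)]
  have hlt : ∀ x : ℤ, x % G * Mm / G < Mm := by
    intro x
    apply Int.ediv_lt_of_lt_mul hG
    have := Int.emod_lt_of_pos x hG
    rw [mul_comm (Mm : ℤ)]
    apply mul_lt_mul_of_pos_right this
    omega
  have hnn : ∀ x : ℤ, 0 ≤ x % G * Mm / G := by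
    intro x
    apply Int.ediv_nonneg _ hG.le
    have := Int.emod_nonneg x hG.ne'
    positivity
  let F : Fin (Mm ^ #(Rf R V) + 1) → ({x // x ∈ Rf R V} → Fin Mm) := fun j r =>
    ⟨(((j : ℕ) : ℤ) * r % G * Mm / G).toNat, by
      have := hlt (((j : ℕ) : ℤ) * r)
      have := hnn (((j : ℕ) : ℤ) * r)
      omega⟩
  have main : ∀ j1 j2 : Fin (Mm ^ #(Rf R V) + 1), j1 < j2 → F j1 = F j2 → ∃ (j : ℤ) (f : ℤ → ℤ), 1 ≤ j ∧ j ≤ (2 * k.toNat + 2) ^ #(Rf R V) ∧ f 0 = 0 ∧ f G = 0 ∧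
      (∀ r, G ∣ j * r - f r) ∧ ∀ r ∈ Rf R V, |f r| * (2 * k + 2) < G := by
    intro j1 j2 hlt12 hF
    have hlt12 : (j1 : ℕ) < (j2 : ℕ) := hlt12
    refine ⟨((j2 : ℕ) : ℤ) - ((j1 : ℕ) : ℤ), fun r => ((j2 : ℕ) : ℤ) * r % G - ((j1 : ℕ) : ℤ) * r % G,
      by omega, ?_, by simp, by simp, ?_, ?_⟩
    · have h2 := j2.2
      have h3 : ((j2 : ℕ) : ℤ) ≤ ((Mm ^ #(Rf R V) : ℕ) : ℤ) := by exact_mod_cast Nat.lt_succ_iff.mp h2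
      have h4 : ((Mm ^ #(Rf R V) : ℕ) : ℤ) = (2 * k.toNat + 2) ^ #(Rf R V) := by
        push_cast [hMm]; rfl
      rw [← h4]
      omega
    · intro r
      have h1 := Int.emod_add_mul_ediv (((j2 : ℕ) : ℤ) * r) G
      have h2 := Int.emod_add_mul_ediv (((j1 : ℕ) : ℤ) * r) G
      refine ⟨((j2 : ℕ) : ℤ) * r / G - ((j1 : ℕ) : ℤ) * r / G, ?_⟩
      linear_combination h2 - h1
    · intro r hr
      have h1 := congrFun hF ⟨r, hr⟩
      simp only [F, Fin.mk.injEq] at h1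
      have h2 : ((j1 : ℕ) : ℤ) * r % G * Mm / G = ((j2 : ℕ) : ℤ) * r % G * Mm / G := by
        have := hnn (((j1 : ℕ) : ℤ) * r)
        have := hnn (((j2 : ℕ) : ℤ) * r)
        omega
      beta_reduce
      generalize ((j1 : ℕ) : ℤ) * r % G = x at h2 ⊢
      generalize ((j2 : ℕ) : ℤ) * r % G = y at h2 ⊢
      have h3 := Int.emod_add_mul_ediv (x * Mm) G
      have h4 := Int.emod_add_mul_ediv (y * Mm) G
      have h5 := Int.emod_lt_of_pos (x * Mm) hG
      have h6 := Int.emod_lt_of_pos (y * Mm) hG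
      have h7 := Int.emod_nonneg (x * Mm) hG.ne'
      have h8 := Int.emod_nonneg (y * Mm) hG.ne'
      rw [h2] at h3
      rw [← hMm']
      have h9 : |y - x| * (Mm:ℤ) = |(y - x) * Mm| := by rw [abs_mul, Nat.abs_cast]
      rw [h9, abs_lt]
      constructor <;> nlinarith
  obtain ⟨j1, j2, hne, hF⟩ := Fintype.exists_ne_map_eq_of_card_lt F (by simp)
  rcases lt_or_gt_of_ne hne with h | h
  · exact main j1 j2 h hF
  · exact main j2 j1 h hF.symm

end Zpart

namespace Zpart
open Finset

theorem small_prime {k : ℤ} (hk : 1 ≤ k) : ∃ G0 : ℤ, ∀ G, G0 ≤ G → ∀ R : Set ℤ, Ext k R → 0 ∈ R → G ∈ R →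
    (∀ n, 1 ≤ n → n < G → n ∉ R) → (∀ x, ∃ i, 0 ≤ i ∧ i < G ∧ x + i ∈ R) →
    ∃ p : ℕ, p.Prime ∧ ∀ r ∈ R, 0 < r → r ≤ (4 * (k + 1)^2) * G - G → (p : ℤ) ∣ r := by
  obtain ⟨n0, hn0⟩ := count_bound hk (4 * (k+1)^2) (by positivity)
  refine ⟨2 * k + (2 * k.toNat + 2)^n0 + 1, fun G hG R hext h0 hGR hgap hwin => ?_⟩
  have hJ0 : (0:ℤ) ≤ (2 * k.toNat + 2)^n0 := by positivity
  have hGpos : 0 < G := by omega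
  have hcount := hn0 G (by omega) R hext hgap
  obtain ⟨i, i0, i1, iR⟩ := hwin (4 * (k + 1)^2 * G - G + 1)
  set v := 4 * (k + 1)^2 * G - G + 1 + i with hv
  have hvKG : v ≤ 4 * (k+1)^2 * G := by omega
  have hvlow : 4 * (k+1)^2 * G - G < v := by omega
  have hkk : 4 * (k+1) * G ≤ 4 * (k+1)^2 * G := by
    apply mul_le_mul_of_nonneg_right _ hGpos.le
    nlinarith
  have hkG : 0 < k * G := by positivity
  have hv2 : 2 * k * G ≤ v := by nlinarith
  have hGv : G ≤ v := by nlinarith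
  obtain ⟨j, f, hj1, hj2, f0, fG, hfd, hfs⟩ := dirichlet hk (R := R) (G := G) (V := 4 * (k+1)^2 * G) hGpos
  have hsub : ∀ r ∈ Rf R v, r ∈ Rf R (4 * (k+1)^2 * G) := fun r hr => by
    rw [mem_Rf] at hr ⊢
    exact ⟨hr.1, by omega, hr.2.2⟩
  have hrel : ∀ a ∈ Rf R v, ∀ b ∈ Rf R v, ∀ t, 1 ≤ t → t ≤ k → b + t * (b - a) ∈ Rf R v →
      f (b + t * (b - a)) = f b + t * (f b - f a) := by
    intro a ha b hb t t1 t2 hc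
    have A1 := hfs a (hsub a ha)
    have B1 := hfs b (hsub b hb)
    have C1 := hfs _ (hsub _ hc)
    have A2 := hfd a
    have B2 := hfd b
    have C2 := hfd (b + t * (b - a))
    set c := b + t * (b - a) with hcdef
    have hdvd : G ∣ f b + t * (f b - f a) - f c := by
      have := (C2.sub (B2.add ((B2.sub A2).mul_left t)))
      have e : j * c - f c - (j * b - f b + t * (j * b - f b - (j * a - f a))) =
          f b + t * (f b - f a) - f c := by
        rw [hcdef]; ring
      rwa [e] at this
    have hz : f b + t * (f b - f a) - f c = 0 := by
      apply Int.eq_zero_of_abs_lt_dvd hdvd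
      have e1 : |f b + t * (f b - f a) - f c| ≤ |f b| + t * (|f b| + |f a|) + |f c| := by
        have h1 := abs_sub (f b + t * (f b - f a)) (f c)
        have h2 := abs_add_le (f b) (t * (f b - f a))
        have h3 := abs_sub (f b) (f a)
        rw [abs_mul, abs_of_pos (show 0 < t by omega)] at h2
        have h4 := mul_le_mul_of_nonneg_left h3 (show 0 ≤ t by omega)
        linarith
      have e2 : t * (|f b| + |f a|) ≤ k * (|f b| + |f a|) := by gcongr
      have e3 : (|f b| + k * (|f b| + |f a|) + |f c|) * (2 * k + 2) < G * (2 * k + 2) := by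
        have := mul_lt_mul_of_pos_left A1 (show 0 < k by omega)
        have := mul_lt_mul_of_pos_left B1 (show 0 < k by omega)
        linarith
      have e4 := lt_of_mul_lt_mul_right e3 (by omega)
      linarith
    linarith
  have hft : ∀ r ∈ Rf R v, v * f r - r * f v = 0 := by
    intro r hr
    have h1 := collinear hk hext hGpos hv2 h0 iR hwin (fun r => v * f r - r * f v) (by simp [f0]) (by ring)
      (by intro a ha b hb t t1 t2 hc
          simp only [hrel a ha b hb t t1 t2 hc]
          ring) r hr
    have h2 := collinear hk hext hGpos hv2 h0 iR hwin (fun r => -(v * f r - r * f v)) (by simp [f0]) (by ring)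
      (by intro a ha b hb t t1 t2 hc
          simp only [hrel a ha b hb t t1 t2 hc]
          ring) r hr
    linarith
  have hfv : f v = 0 := by
    have := hft G (mem_Rf.mpr ⟨hGpos.le, hGv, hGR⟩)
    rw [fG] at this
    have h2 : G * f v = 0 := by linarith
    rcases mul_eq_zero.mp h2 with h | h
    · omega
    · exact h
  have hf0 : ∀ r ∈ Rf R v, f r = 0 := by
    intro r hr
    have := hft r hr
    rw [hfv] at this
    have h2 : v * f r = 0 := by linarith
    rcases mul_eq_zero.mp h2 with h | h
    · omega
    · exact h
  have hdiv : ∀ r ∈ Rf R v, G ∣ j * r := by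
    intro r hr
    have := hfd r
    rwa [hf0 r hr, sub_zero] at this
  have hjG : j < G := by
    have : ((2 * k.toNat + 2 : ℤ)) ^ #(Rf R (4 * (k+1)^2 * G)) ≤ (2 * k.toNat + 2)^n0 :=
      pow_le_pow_right₀ (by omega) hcount
    omega
  set g := G.natAbs / Nat.gcd G.natAbs j.natAbs with hg
  have hgcd : 0 < Nat.gcd G.natAbs j.natAbs := Nat.gcd_pos_of_pos_left _ (by omega)
  have hg1 : g ≠ 1 := by
    intro h
    have h1 : G.natAbs = Nat.gcd G.natAbs j.natAbs := by
      have := Nat.div_mul_cancel (Nat.gcd_dvd_left G.natAbs j.natAbs)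
      rw [← hg, h, one_mul] at this
      exact this.symm
    have h2 : G.natAbs ∣ j.natAbs := Nat.gcd_eq_left_iff_dvd.mp h1.symm
    have := Nat.le_of_dvd (by omega) h2
    omega
  refine ⟨g.minFac, Nat.minFac_prime hg1, fun r hr hr0 hrK => ?_⟩
  have h1 := hdiv r (mem_Rf.mpr ⟨hr0.le, by omega, hr⟩)
  have h2 : G.natAbs ∣ j.natAbs * r.natAbs := by
    rw [← Int.natAbs_mul]
    exact Int.natAbs_dvd_natAbs.mpr h1
  have h3 : g ∣ r.natAbs := by
    have hco := Nat.coprime_div_gcd_div_gcd hgcd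
    apply hco.dvd_of_dvd_mul_left
    apply Nat.dvd_of_mul_dvd_mul_right hgcd
    rw [Nat.div_mul_cancel (Nat.gcd_dvd_left _ _), mul_right_comm, Nat.div_mul_cancel (Nat.gcd_dvd_right _ _)]
    exact h2
  exact Int.natCast_dvd.mpr ((Nat.minFac_dvd g).trans h3)

theorem all_div {k : ℤ} (hk : 1 ≤ k) {G : ℤ} (hG : 0 < G) {R : Set ℤ} (hext : Ext k R) (h0 : 0 ∈ R)
    (hAP : ∀ m, 1 ≤ m → m ≤ k + 1 → ∀ x, ∃ i, 0 ≤ i ∧ i < G ∧ x + m * i ∈ R)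
    {p : ℕ} (hp : p.Prime)
    (hpK : ∀ r ∈ R, 0 < r → r ≤ (4 * (k + 1)^2) * G - G → (p : ℤ) ∣ r) :
    ∀ r ∈ R, 0 < r → (p : ℤ) ∣ r := by
  have hkk : 4 * (k+1) * G ≤ 4 * (k+1)^2 * G := by
    apply mul_le_mul_of_nonneg_right _ hG.le
    nlinarith
  have hkG : 0 < k * G := by positivity
  have hpp : Prime (p : ℤ) := Nat.prime_iff_prime_int.mp hp
  have hp2 : 2 ≤ (p:ℤ) := by exact_mod_cast hp.two_le
  have hpk : k + 1 < p := by
    by_contra hc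
    push Not at hc
    obtain ⟨i, i0, i1, i2⟩ := hAP p (by omega) hc 1
    have hle : (p:ℤ) * i ≤ (k+1) * G := by gcongr
    have hnn : 0 ≤ (p:ℤ) * i := by positivity
    have h1 := hpK _ i2 (by omega) (by nlinarith)
    have h2 : (p:ℤ) ∣ 1 := by
      have := h1.sub (Dvd.intro i rfl : (p:ℤ) ∣ p * i)
      simpa using this
    have := Int.le_of_dvd one_pos h2
    omega
  have hnd : ∀ t : ℤ, 0 < t → t ≤ k + 1 → ¬ (p:ℤ) ∣ t := fun t h1 h2 h3 => by
    have := Int.le_of_dvd h1 h3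
    omega
  by_contra hcon
  push Not at hcon
  obtain ⟨w, ⟨hwR, hw0, hwp⟩, hwmin⟩ := Int.exists_least_of_bdd (P := fun r => r ∈ R ∧ 0 < r ∧ ¬ (p:ℤ) ∣ r)
    ⟨0, fun z hz => hz.2.1.le⟩ hcon
  have hwdiv : ∀ c ∈ R, 0 ≤ c → c < w → (p:ℤ) ∣ c := by
    intro c hc hc0 hcw
    by_contra h
    rcases lt_or_eq_of_le hc0 with h1 | h1
    · have := hwmin c ⟨hc, h1, h⟩
      omega
    · rw [← h1] at h; exact h (dvd_zero _)
  have hwK : 4 * (k+1)^2 * G - G < w := by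
    by_contra h
    exact hwp (hpK w hwR hw0 (by omega))
  -- relation
  have hrel : ∀ ρ ∈ R, w < ρ → k * (ρ - w) ≤ w → ∃ t, 1 ≤ t ∧ t ≤ k ∧ (p:ℤ) ∣ (1 + t) * w - t * ρ := by
    intro ρ hρ h1 h2
    obtain ⟨t, t1, t2, t3⟩ := hext ρ hρ w hwR
    refine ⟨t, t1, t2, ?_⟩
    have b1 : t * (ρ - w) ≤ k * (ρ - w) := by gcongr
    have b2 : 0 < t * (ρ - w) := mul_pos (by omega) (by omega)
    have := hwdiv _ t3 (by linarith) (by linarith)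
    convert this using 1; ring
  have hnot : ∀ ρ ∈ R, w < ρ → k * (ρ - w) ≤ w → ¬ (p:ℤ) ∣ ρ := by
    intro ρ hρ h1 h2 h3
    obtain ⟨t, t1, t2, t3⟩ := hrel ρ hρ h1 h2
    have h4 : (p:ℤ) ∣ (1+t) * w := by
      have := t3.add (h3.mul_left t)
      simpa using this
    rcases hpp.dvd_or_dvd h4 with h | h
    · exact hnd _ (by omega) (by omega) h
    · exact hwp h
  have hpair : ∀ n : ℕ, ∀ a ∈ R, ∀ b ∈ R, w < a → (a - w).toNat ≤ n → a < b → k * (b - w) ≤ w → ¬ (p:ℤ) ∣ b - a := by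
    intro n
    induction n with
    | zero => intro a _ b _ h1 h2; omega
    | succ n ih =>
      intro a ha b hb h1 h2 h3 h4 h5
      have haw : k * (a - w) ≤ w := by nlinarith
      obtain ⟨t, t1, t2, t3⟩ := hext b hb a ha
      have b1 : t * (b - a) ≤ k * (b - a) := by gcongr
      have b2 : 0 < t * (b - a) := mul_pos (by omega) (by omega)
      have b3 : t * (a - b) = - (t * (b - a)) := by ring
      have b4 : k * (b - a) ≤ w := by nlinarith
      set c := a + t * (a - b) with hc
      have hca : (p:ℤ) ∣ a - c := by
        have : a - c = t * (b - a) := by rw [hc]; ring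
        rw [this]; exact h5.mul_left t
      have hclt : c < a := by omega
      have hc0 : 0 ≤ c := by omega
      rcases lt_trichotomy c w with hcw | hcw | hcw
      · have h6 := hwdiv c t3 hc0 hcw
        have h7 := hca.add h6
        rw [sub_add_cancel] at h7
        exact hnot a ha h1 haw h7
      · obtain ⟨s, s1, s2, s3⟩ := hrel a ha h1 haw
        rw [hcw] at hca
        have h7 := s3.add (hca.mul_left s)
        have h8 : (1 + s) * w - s * a + s * (a - w) = w := by ring
        rw [h8] at h7
        exact hwp h7
      · exact ih c t3 a ha hcw (by omega) hclt haw hca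
  -- pigeonhole
  have hbig : k * ((k + 1) * G) ≤ w := by nlinarith
  have hch : ∀ i : Fin (k.toNat + 1), ∃ ρ ∈ R, w + (i:ℕ) * G < ρ ∧ ρ ≤ w + ((i:ℕ) + 1) * G := by
    intro i
    obtain ⟨s, s0, s1, s2⟩ := hAP 1 le_rfl (by omega) (w + (i:ℕ) * G + 1)
    exact ⟨_, s2, by omega, by linarith⟩
  choose ρ hρR hρ1 hρ2 using hch
  have hρw : ∀ i, w < ρ i := fun i => by
    have := hρ1 i
    have : 0 ≤ ((i:ℕ):ℤ) * G := by positivity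
    omega
  have hρk : ∀ i, k * (ρ i - w) ≤ w := fun i => by
    have h1 := hρ2 i
    have h2 : ((i:ℕ):ℤ) + 1 ≤ k + 1 := by have := i.2; omega
    have h3 : (((i:ℕ):ℤ) + 1) * G ≤ (k+1) * G := by gcongr
    have h4 : k * (ρ i - w) ≤ k * ((k+1) * G) := by gcongr; omega
    linarith
  choose t t1 t2 t3 using fun i => hrel (ρ i) (hρR i) (hρw i) (hρk i)
  obtain ⟨i, _, j, _, hij, htt⟩ := exists_ne_map_eq_of_card_lt_of_maps_to (s := univ) (t := Finset.Icc 1 k) (f := t)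
    (by simp) (fun i _ => mem_coe.mpr (Finset.mem_Icc.mpr ⟨t1 i, t2 i⟩))
  have fin : ∀ i j, i < j → t i = t j → False := by
    intro i j hij htt
    have h1 := (t3 i).sub (t3 j)
    rw [← htt] at h1
    have h2 : (p:ℤ) ∣ t i * (ρ j - ρ i) := by
      have e : (1 + t i) * w - t i * ρ i - ((1 + t i) * w - t i * ρ j) = t i * (ρ j - ρ i) := by ring
      rwa [e] at h1
    rcases hpp.dvd_or_dvd h2 with h | h
    · exact hnd _ (by linarith [t1 i]) (by linarith [t2 i]) h
    · refine hpair _ (ρ i) (hρR i) (ρ j) (hρR j) (hρw i) le_rfl ?_ (hρk j) h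
      have h3 : ((i:ℕ):ℤ) + 1 ≤ (j:ℕ) := by
        have : (i:ℕ) < (j:ℕ) := hij
        omega
      have h4 : (((i:ℕ):ℤ) + 1) * G ≤ (j:ℕ) * G := by gcongr
      have := hρ1 j
      have := hρ2 i
      omega
  rcases lt_or_gt_of_ne hij with h | h
  · exact fin i j h htt
  · exact fin j i h htt.symm

end Zpart


theorem statement0 (k : ℕ) (hk : 0 < k) (δ : ℝ) (hδ : 0 < δ) :
    ∃ q₀ : ℕ, ∀ q : ℕ, q.Prime → q₀ ≤ q →
      ∀ A : Set (ZMod q),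
        δ * q ≤ Nat.card ↥(Aᶜ) →
        2 ≤ Nat.card ↥A →
        ∃ x d : ZMod q, d ≠ 0 ∧ x ∈ A ∧ x + d ∈ A ∧
          ∀ i : ℕ, 2 ≤ i → i ≤ k + 1 → x + (i : ZMod q) * d ∉ A := by
  classical
  have hk1 : (1 : ℤ) ≤ (k : ℤ) := by omega
  obtain ⟨G0, hG0⟩ := Zpart.small_prime hk1
  obtain ⟨q0, hq0⟩ := DHJ.szemeredi (G0.toNat) hδ
  refine ⟨max q0 (k + 2), fun q hq hqq A hA hA2 => ?_⟩
  haveI : Fact q.Prime := ⟨hq⟩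
  have hqq0 : q0 ≤ q := (le_max_left _ _).trans hqq
  have hqk : k + 2 ≤ q := (le_max_right _ _).trans hqq
  by_contra hno
  have hno' : ∀ x d : ZMod q, d ≠ 0 → x ∈ A → x + d ∈ A →
      ∃ i : ℕ, 2 ≤ i ∧ i ≤ k + 1 ∧ x + (i : ZMod q) * d ∈ A := by
    intro x d hd hx hxd
    by_contra hc
    exact hno ⟨x, d, hd, hx, hxd, fun i h1 h2 h3 => hc ⟨i, h1, h2, h3⟩⟩
  let Run : ℕ → Prop := fun n => ∃ x d : ZMod q, d ≠ 0 ∧ ∀ i : ℕ, i < n → x + (i : ZMod q) * d ∉ A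
  -- two distinct elements of `A`
  obtain ⟨a, ha, b, hb, hab⟩ : ∃ a ∈ A, ∃ b ∈ A, a ≠ b := by
    have h1 : 1 < Nat.card ↥A := by omega
    have : Nontrivial ↥A := (Finite.one_lt_card_iff_nontrivial).mp h1
    obtain ⟨⟨a, ha⟩, ⟨b, hb⟩, hab⟩ := exists_pair_ne ↥A
    exact ⟨a, ha, b, hb, fun h => hab (Subtype.ext h)⟩
  have hcover : ∀ x d y : ZMod q, d ≠ 0 → ∃ i : ℕ, i < q ∧ x + (i : ZMod q) * d = y := by
    intro x d y hd
    refine ⟨((y - x) / d).val, ZMod.val_lt _, ?_⟩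
    rw [ZMod.natCast_zmod_val, div_mul_cancel₀ _ hd]
    ring
  have hRunq : ¬ Run q := by
    rintro ⟨x, d, hd, h⟩
    obtain ⟨i, hi, e⟩ := hcover x d a hd
    exact h i hi (e ▸ ha)
  have hmono : ∀ m n, m ≤ n → Run n → Run m := by
    rintro m n hmn ⟨x, d, hd, h⟩
    exact ⟨x, d, hd, fun i hi => h i (by omega)⟩
  have hRun0 : Run (G0.toNat + 1) := by
    obtain ⟨x, d, hd, h⟩ := hq0 q hq hqq0 Aᶜ hA
    exact ⟨x, d, hd, fun i hi => h i (by omega)⟩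
  have hex : ∃ n, ¬ Run n := ⟨q, hRunq⟩
  obtain ⟨n, hn, hnmin⟩ : ∃ n, ¬ Run n ∧ ∀ m < n, Run m :=
    ⟨Nat.find hex, Nat.find_spec hex, fun m hm => not_not.mp (Nat.find_min hex hm)⟩
  have hnG : G0.toNat + 1 < n := by
    by_contra hc
    exact hn (hmono _ _ (by omega) hRun0)
  obtain ⟨l, rfl⟩ : ∃ l, n = l + 1 := ⟨n - 1, by omega⟩
  obtain ⟨x, d, hd, hrun⟩ := hnmin l (by omega)
  have hleft : x - d ∈ A := by
    by_contra hc
    refine hn ⟨x - d, d, hd, fun i hi => ?_⟩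
    rcases i with _ | i
    · simpa using hc
    · have := hrun i (by omega)
      have e : x - d + ((i + 1 : ℕ) : ZMod q) * d = x + (i : ZMod q) * d := by push_cast; ring
      rwa [e]
  have hright : x + (l : ZMod q) * d ∈ A := by
    by_contra hc
    refine hn ⟨x, d, hd, fun i hi => ?_⟩
    rcases Nat.lt_succ_iff_lt_or_eq.mp hi with h | h
    · exact hrun i h
    · rw [h]; exact hc
  let R : Set ℤ := {n | x - d + (n : ZMod q) * d ∈ A}
  have hR : ∀ n : ℤ, n ∈ R ↔ x - d + (n : ZMod q) * d ∈ A := fun n => Iff.rfl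
  have h0R : (0 : ℤ) ∈ R := by rw [hR]; simpa using hleft
  have hGR : ((l + 1 : ℕ) : ℤ) ∈ R := by
    rw [hR]
    have e : x - d + (((l + 1 : ℕ) : ℤ) : ZMod q) * d = x + (l : ZMod q) * d := by push_cast; ring
    rwa [e]
  have hgap : ∀ n : ℤ, 1 ≤ n → n < ((l + 1 : ℕ) : ℤ) → n ∉ R := by
    intro n h1 h2 h3
    obtain ⟨m, rfl⟩ : ∃ m : ℕ, n = (m : ℤ) + 1 := ⟨(n - 1).toNat, by omega⟩
    rw [hR] at h3
    refine hrun m (by omega) ?_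
    have e : x - d + (((m : ℤ) + 1 : ℤ) : ZMod q) * d = x + (m : ZMod q) * d := by push_cast; ring
    rwa [e] at h3
  have hext : Zpart.Ext (k : ℤ) R := by
    intro a ha b hb
    rw [hR] at ha hb
    by_cases hz : ((b - a : ℤ) : ZMod q) = 0
    · refine ⟨1, le_rfl, hk1, ?_⟩
      rw [hR]
      push_cast at hz ⊢
      rw [hz]
      simpa using hb
    · obtain ⟨i, i1, i2, i3⟩ := hno' (x - d + (a : ZMod q) * d) (((b - a : ℤ) : ZMod q) * d)
        (mul_ne_zero hz hd) ha (by
          have e : x - d + (a : ZMod q) * d + ((b - a : ℤ) : ZMod q) * d = x - d + (b : ZMod q) * d := by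
            push_cast; ring
          rwa [e])
      refine ⟨(i : ℤ) - 1, by omega, by omega, ?_⟩
      rw [hR]
      have e : x - d + ((b + ((i : ℤ) - 1) * (b - a) : ℤ) : ZMod q) * d =
          x - d + (a : ZMod q) * d + (i : ZMod q) * (((b - a : ℤ) : ZMod q) * d) := by
        push_cast; ring
      rwa [e]
  have hAP : ∀ m : ℤ, 1 ≤ m → m ≤ (k : ℤ) + 1 → ∀ y : ℤ,
      ∃ i : ℤ, 0 ≤ i ∧ i < ((l + 1 : ℕ) : ℤ) ∧ y + m * i ∈ R := by
    intro m h1 h2 y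
    by_contra hc
    have hm : (m : ZMod q) ≠ 0 := by
      intro h
      rw [ZMod.intCast_zmod_eq_zero_iff_dvd] at h
      have := Int.le_of_dvd (by omega) h
      omega
    refine hn ⟨x - d + (y : ZMod q) * d, (m : ZMod q) * d, mul_ne_zero hm hd, fun i hi h => ?_⟩
    refine hc ⟨i, by omega, by omega, ?_⟩
    rw [hR]
    have e : x - d + ((y + m * (i : ℤ) : ℤ) : ZMod q) * d =
        x - d + (y : ZMod q) * d + (i : ZMod q) * ((m : ZMod q) * d) := by
      push_cast; ring
    rwa [e]
  obtain ⟨p, hp, hpK⟩ := hG0 ((l + 1 : ℕ) : ℤ) (by omega) R hext h0R hGR hgap (by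
    intro y
    obtain ⟨i, i0, i1, i2⟩ := hAP 1 le_rfl (by omega) y
    exact ⟨i, i0, i1, by simpa using i2⟩)
  have hall := Zpart.all_div hk1 (by omega) hext h0R hAP hp hpK
  have hqR : (q : ℤ) ∈ R := by rw [hR]; simpa using hleft
  have hpq : p = q := by
    have h1 := hall q hqR (by have := hq.pos; omega)
    exact (Nat.prime_dvd_prime_iff_eq hp hq).mp (by exact_mod_cast h1)
  have hone : ∀ y ∈ A, y = x - d := by
    intro y hy
    obtain ⟨i, hi, e⟩ := hcover (x - d) d y hd
    rcases Nat.eq_zero_or_pos i with h | h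
    · rw [← e, h]; simp
    · have hiR : (i : ℤ) ∈ R := by
        rw [hR, Int.cast_natCast, e]; exact hy
      have h1 := hall i hiR (by omega)
      rw [hpq] at h1
      have := Int.le_of_dvd (by omega) h1
      omega
  exact hab ((hone a ha).trans (hone b hb).symm)
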